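/- arXiv:1809.08679 — 3 statements merged into one kernel-verified Lean document; each statement's English description precedes it below -/
import Mathlib

section
/- Maximum principle for doubly nonlinear equations (Theorem 2.8(a), case k>1): Suppose H satisfies Conditions A–C with k₁ > 0 (so k > 1, γ = k₁ + 2 > 2, γ* = γ/(γ−2)) and Λ^sup < ∞. Let f : [0,∞) → [0,∞) be a C¹ increasing function such that s ↦ f(s)^{1/(k−1)} is concave, and let g : ℝⁿ → (0,∞) be continuous with 0 < inf_{ℝⁿ} g ≤ sup_{ℝⁿ} g < ∞. Let φ be a C², increasing, nonnegative function defined on an interval of ℝ that is unbounded above, satisfying φ′(τ) = f(φ(τ))^{1/(k−1)} for all τ in its domain. Let u be upper semicontinuous on the closure of ℝⁿ_T with u > 0, a viscosity subsolution of H(Du, D²u) − f(u)u_t = 0 in ℝⁿ_T, with u(x,0) ≤ g(x) for all x ∈ ℝⁿ. If there is a function ρ with ρ(R)/R^{γ*} → 0 as R → ∞ such that sup_{B^R_T} u ≤ φ(ρ(R)) for all large R, then sup_{ℝⁿ_T} u ≤ sup_{ℝⁿ} g. -/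
open Set MeasureTheory

noncomputable section

/-- The rank-one matrix `q ⊗ q`. -/
def outerProd {n : ℕ} (q : EuclideanSpace ℝ (Fin n)) : Matrix (Fin n) (Fin n) ℝ :=
  Matrix.of fun i j => q i * q j

/-- The Loewner partial order on real matrices: `X ≤ Y` iff `Y - X` is positive semidefinite. -/
def LoewnerLE {n : ℕ} (X Y : Matrix (Fin n) (Fin n) ℝ) : Prop := (Y - X).PosSemidef

/-- Conditions A (monotonicity), B (homogeneity) and C (growth at infinity) on `H`. -/
structure ConditionsABC (n : ℕ)
    (H : EuclideanSpace ℝ (Fin n) → Matrix (Fin n) (Fin n) ℝ → ℝ) (k₁ : ℝ) : Prop where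
  continuous : Continuous fun p : EuclideanSpace ℝ (Fin n) × Matrix (Fin n) (Fin n) ℝ => H p.1 p.2
  monotone : ∀ q X Y, X.IsSymm → Y.IsSymm → LoewnerLE X Y → H q X ≤ H q Y
  zero_eq : ∀ q, H q 0 = 0
  k₁_nonneg : 0 ≤ k₁
  hom_q : ∀ (θ : ℝ) (q : EuclideanSpace ℝ (Fin n)) (X), H (θ • q) X = |θ| ^ k₁ * H q X
  hom_X : ∀ (θ : ℝ), 0 < θ → ∀ q X, H q (θ • X) = θ * H q X
  max_neg : ∀ e : EuclideanSpace ℝ (Fin n), ‖e‖ = 1 → H e (-1) < 0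
  min_pos : ∀ e : EuclideanSpace ℝ (Fin n), ‖e‖ = 1 → 0 < H e 1

/-- `Λ^sup = sup_λ max_{|e|=1} H(e, λ e⊗e + I) < ∞`. -/
def LambdaSupFinite (n : ℕ)
    (H : EuclideanSpace ℝ (Fin n) → Matrix (Fin n) (Fin n) ℝ → ℝ) : Prop :=
  ∃ C : ℝ, ∀ (lam : ℝ) (e : EuclideanSpace ℝ (Fin n)), ‖e‖ = 1 →
    H e (lam • outerProd e + 1) ≤ C

/-- `Λ^inf = inf_λ min_{|e|=1} H(e, λ e⊗e - I) > -∞`. -/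
def LambdaInfFinite (n : ℕ)
    (H : EuclideanSpace ℝ (Fin n) → Matrix (Fin n) (Fin n) ℝ → ℝ) : Prop :=
  ∃ C : ℝ, ∀ (lam : ℝ) (e : EuclideanSpace ℝ (Fin n)), ‖e‖ = 1 →
    C ≤ H e (lam • outerProd e - 1)

/-- The spatial gradient of `ψ` at `x`, as a vector in `ℝⁿ`. -/
def spaceGrad {n : ℕ} (ψ : EuclideanSpace ℝ (Fin n) → ℝ) (x : EuclideanSpace ℝ (Fin n)) :
    EuclideanSpace ℝ (Fin n) :=
  (EuclideanSpace.equiv (Fin n) ℝ).symm fun i => fderiv ℝ ψ x (EuclideanSpace.single i 1)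

/-- The spatial Hessian matrix of `ψ` at `x`. -/
def spaceHess {n : ℕ} (ψ : EuclideanSpace ℝ (Fin n) → ℝ) (x : EuclideanSpace ℝ (Fin n)) :
    Matrix (Fin n) (Fin n) ℝ :=
  Matrix.of fun i j =>
    fderiv ℝ (fun y => fderiv ℝ ψ y (EuclideanSpace.single j 1)) x (EuclideanSpace.single i 1)

/-- Viscosity subsolution of `F(t, u, Du, D²u, u_t) = 0` on `Ω ⊆ ℝⁿ × ℝ`, tested against
functions `φ(x,t)` that are C² in `x` and C¹ in `t`: whenever `u - φ` has a local maximum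
at `(x₀,t₀) ∈ Ω`, one has `F(t₀, u(x₀,t₀), Dφ, D²φ, φ_t) ≥ 0` there. -/
def ParabolicSubsolution {n : ℕ}
    (F : ℝ → ℝ → EuclideanSpace ℝ (Fin n) → Matrix (Fin n) (Fin n) ℝ → ℝ → ℝ)
    (Ω : Set (EuclideanSpace ℝ (Fin n) × ℝ)) (u : EuclideanSpace ℝ (Fin n) × ℝ → ℝ) : Prop :=
  ∀ φ : EuclideanSpace ℝ (Fin n) → ℝ → ℝ,
    (∀ t, ContDiff ℝ 2 fun x => φ x t) →
    (∀ x, ContDiff ℝ 1 fun t => φ x t) →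
    ∀ x₀ t₀, (x₀, t₀) ∈ Ω →
      IsLocalMaxOn (fun p => u p - φ p.1 p.2) Ω (x₀, t₀) →
      0 ≤ F t₀ (u (x₀, t₀)) (spaceGrad (fun x => φ x t₀) x₀) (spaceHess (fun x => φ x t₀) x₀)
          (deriv (φ x₀) t₀)

/-- Viscosity supersolution of `F(t, u, Du, D²u, u_t) = 0` on `Ω ⊆ ℝⁿ × ℝ`. -/
def ParabolicSupersolution {n : ℕ}
    (F : ℝ → ℝ → EuclideanSpace ℝ (Fin n) → Matrix (Fin n) (Fin n) ℝ → ℝ → ℝ)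
    (Ω : Set (EuclideanSpace ℝ (Fin n) × ℝ)) (u : EuclideanSpace ℝ (Fin n) × ℝ → ℝ) : Prop :=
  ∀ φ : EuclideanSpace ℝ (Fin n) → ℝ → ℝ,
    (∀ t, ContDiff ℝ 2 fun x => φ x t) →
    (∀ x, ContDiff ℝ 1 fun t => φ x t) →
    ∀ x₀ t₀, (x₀, t₀) ∈ Ω →
      IsLocalMinOn (fun p => u p - φ p.1 p.2) Ω (x₀, t₀) →
      F t₀ (u (x₀, t₀)) (spaceGrad (fun x => φ x t₀) x₀) (spaceHess (fun x => φ x t₀) x₀)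
          (deriv (φ x₀) t₀) ≤ 0

open Filter

lemma mp_normsq_hasFDerivAt {n : ℕ} (z y : EuclideanSpace ℝ (Fin n)) :
    HasFDerivAt (fun x : EuclideanSpace ℝ (Fin n) => 1 + ‖x - z‖ ^ 2) (2 • innerSL ℝ (y - z)) y := by
  have h := ((hasFDerivAt_id y).sub_const z).norm_sq
  have h2 := h.const_add 1
  refine h2.congr_fderiv ?_
  ext v
  simp

lemma mp_radial {n : ℕ} (Q Q' : ℝ → ℝ) (q2 : ℝ) (z x : EuclideanSpace ℝ (Fin n))
    (hQ : ∀ s > 0, HasDerivAt Q (Q' s) s) (hQ' : HasDerivAt Q' q2 (1 + ‖x - z‖ ^ 2)) :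
    spaceGrad (fun x => Q (1 + ‖x - z‖ ^ 2)) x = (2 * Q' (1 + ‖x - z‖ ^ 2)) • (x - z) ∧
    spaceHess (fun x => Q (1 + ‖x - z‖ ^ 2)) x =
      (2 * Q' (1 + ‖x - z‖ ^ 2)) • (1 : Matrix (Fin n) (Fin n) ℝ) + (4 * q2) • outerProd (x - z) := by
  have key : ∀ (y : EuclideanSpace ℝ (Fin n)) (i : Fin n),
      fderiv ℝ (fun x => Q (1 + ‖x - z‖ ^ 2)) y (EuclideanSpace.single i 1)
        = 2 * Q' (1 + ‖y - z‖ ^ 2) * (y i - z i) := by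
    intro y i
    have h := (hQ (1 + ‖y - z‖ ^ 2) (by positivity)).comp_hasFDerivAt y (mp_normsq_hasFDerivAt z y)
    have h' : fderiv ℝ (fun x => Q (1 + ‖x - z‖ ^ 2)) y = _ := h.fderiv
    rw [h']
    simp [EuclideanSpace.inner_single_right]
    ring
  constructor
  · ext i
    simp [spaceGrad, key]
  · ext i j
    simp only [spaceHess, key, Matrix.of_apply]
    have h1 := (hQ'.comp_hasFDerivAt x (mp_normsq_hasFDerivAt z x)).const_mul 2
    have h2 : HasFDerivAt (fun y : EuclideanSpace ℝ (Fin n) => y j - z j)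
        (EuclideanSpace.proj j : EuclideanSpace ℝ (Fin n) →L[ℝ] ℝ) x :=
      ((EuclideanSpace.proj j : EuclideanSpace ℝ (Fin n) →L[ℝ] ℝ).hasFDerivAt).sub_const (z j)
    have h3 := h1.mul h2
    have h' : fderiv ℝ (fun y => 2 * Q' (1 + ‖y - z‖ ^ 2) * (y j - z j)) x = _ := h3.fderiv
    rw [h']
    simp [EuclideanSpace.inner_single_right, outerProd, Matrix.one_apply, eq_comm]
    ring

lemma mp_H_bound {n : ℕ} {H : EuclideanSpace ℝ (Fin n) → Matrix (Fin n) (Fin n) ℝ → ℝ} {k₁ : ℝ}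
    (hH : ConditionsABC n H k₁) (hk₁ : 0 < k₁) {C : ℝ}
    (hC : ∀ (lam : ℝ) (e : EuclideanSpace ℝ (Fin n)), ‖e‖ = 1 → H e (lam • outerProd e + 1) ≤ C)
    (α β : ℝ) (hα : 0 < α) (y : EuclideanSpace ℝ (Fin n)) :
    H (α • y) (α • (1 : Matrix (Fin n) (Fin n) ℝ) + β • outerProd y) ≤
      C * α ^ (k₁ + 1) * ‖y‖ ^ k₁ := by
  by_cases hy : y = 0
  · subst hy
    have := hH.hom_q 0 0 (α • (1 : Matrix (Fin n) (Fin n) ℝ) + β • outerProd 0)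
    rw [smul_zero] at this ⊢
    rw [this]
    simp [Real.zero_rpow hk₁.ne']
  · have hr : 0 < ‖y‖ := norm_pos_iff.mpr hy
    set e := (‖y‖⁻¹) • y with he
    have hen : ‖e‖ = 1 := by
      rw [he, norm_smul, norm_inv, norm_norm]; field_simp
    have hye : y = ‖y‖ • e := by
      rw [he, smul_smul, mul_inv_cancel₀ hr.ne', one_smul]
    have hX : α • (1 : Matrix (Fin n) (Fin n) ℝ) + β • outerProd y =
        α • ((β * ‖y‖ ^ 2 / α) • outerProd e + 1) := by
      ext i j
      have e1 : ∀ i, e i = ‖y‖⁻¹ * y i := fun i => by simp [he]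
      simp [outerProd, e1]
      field_simp
      ring
    have hq : α • y = (α * ‖y‖) • e := by rw [mul_smul, ← hye]
    rw [hX, hH.hom_X α hα, hq, hH.hom_q, abs_of_pos (by positivity), Real.mul_rpow hα.le hr.le,
      Real.rpow_add_one hα.ne']
    have := hC (β * ‖y‖ ^ 2 / α) e hen
    have hp : 0 < α * (α ^ k₁ * ‖y‖ ^ k₁) := by positivity
    nlinarith [mul_le_mul_of_nonneg_left this hp.le]

/-- The primitive of `1/F`. -/
def mpG (F : ℝ → ℝ) (y : ℝ) : ℝ := ∫ s in (1:ℝ)..y, 1 / F s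

lemma mpG_deriv {F : ℝ → ℝ} (hF : ∀ y > 0, 0 < F y) (hc : ∀ y > 0, ContinuousAt F y)
    {y : ℝ} (hy : 0 < y) : HasDerivAt (mpG F) (1 / F y) y := by
  have hcont : ∀ y > 0, ContinuousAt (fun s => 1 / F s) y := fun y hy =>
    continuousAt_const.div (hc y hy) (hF y hy).ne'
  have hco : ContinuousOn (fun s => 1 / F s) (Ioi 0) := fun y hy => (hcont y hy).continuousWithinAt
  refine intervalIntegral.integral_hasDerivAt_right ?_ ?_ (hcont y hy)
  · apply ContinuousOn.intervalIntegrable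
    apply hco.mono
    intro s hs
    rcases le_total 1 y with h | h
    · rw [uIcc_of_le h] at hs; exact lt_of_lt_of_le one_pos hs.1
    · rw [uIcc_of_ge h] at hs; exact lt_of_lt_of_le hy hs.1
  · exact hco.stronglyMeasurableAtFilter isOpen_Ioi y hy

lemma mpG_mono {F : ℝ → ℝ} (hF : ∀ y > 0, 0 < F y) (hc : ∀ y > 0, ContinuousAt F y) :
    StrictMonoOn (mpG F) (Ioi 0) := by
  apply strictMonoOn_of_deriv_pos (convex_Ioi 0)
  · exact fun y hy => (mpG_deriv hF hc hy).continuousAt.continuousWithinAt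
  · intro y hy
    rw [interior_Ioi] at hy
    rw [(mpG_deriv hF hc hy).deriv]
    exact one_div_pos.mpr (hF y hy)

/-- touching from above by a quadratic polynomial in the transformed variable -/
lemma mp_touch {F : ℝ → ℝ} (hF : ∀ y > 0, 0 < F y) (hd : ∀ y > 0, DifferentiableAt ℝ F y)
    {y₀ : ℝ} (hy₀ : 0 < y₀) :
    ∃ K : ℝ, ∀ᶠ τ in nhds (mpG F y₀), ∀ y > 0, mpG F y ≤ τ →
      y ≤ y₀ + F y₀ * (τ - mpG F y₀) + K * (τ - mpG F y₀) ^ 2 := by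
  have hc : ∀ y > 0, ContinuousAt F y := fun y hy => (hd y hy).continuousAt
  set τ₀ := mpG F y₀ with hτ₀
  set K : ℝ := (deriv F y₀ * F y₀ + 1) / 2 with hK
  set P : ℝ → ℝ := fun τ => y₀ + F y₀ * (τ - τ₀) + K * (τ - τ₀) ^ 2 with hP
  have hPτ : P τ₀ = y₀ := by simp [hP]
  have hPd : ∀ τ, HasDerivAt P (F y₀ + 2 * K * (τ - τ₀)) τ := by
    intro τ
    have h0 : HasDerivAt (fun τ : ℝ => τ - τ₀) 1 τ := (hasDerivAt_id τ).sub_const τ₀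
    have := ((h0.const_mul (F y₀)).const_add y₀).add ((h0.pow 2).const_mul K)
    refine this.congr_deriv ?_
    simp; ring
  have hPc : ContinuousAt P τ₀ := (hPd τ₀).continuousAt
  have hPpos : ∀ᶠ τ in nhds τ₀, 0 < P τ :=
    hPc.eventually (by rw [hPτ]; exact lt_mem_nhds hy₀)
  set q : ℝ → ℝ := fun τ => mpG F (P τ) - τ with hq
  have hqd : ∀ τ, 0 < P τ → HasDerivAt q (1 / F (P τ) * (F y₀ + 2 * K * (τ - τ₀)) - 1) τ := by
    intro τ hτ
    exact ((mpG_deriv hF hc hτ).comp τ (hPd τ)).sub (hasDerivAt_id τ)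
  have hpos0 : 0 < P τ₀ := by rw [hPτ]; exact hy₀
  have hF0 := hF y₀ hy₀
  have hderiv : deriv q =ᶠ[nhds τ₀] fun τ => 1 / F (P τ) * (F y₀ + 2 * K * (τ - τ₀)) - 1 := by
    filter_upwards [hPpos] with τ hτ using (hqd τ hτ).deriv
  have hmin : IsLocalMin q τ₀ := by
    apply isLocalMin_of_deriv_deriv_pos
    · rw [hderiv.deriv_eq]
      have hFP : HasDerivAt (fun τ => F (P τ)) (deriv F y₀ * (F y₀ + 2 * K * (τ₀ - τ₀))) τ₀ := by
        have h1 : HasDerivAt F (deriv F y₀) (P τ₀) := by rw [hPτ]; exact (hd y₀ hy₀).hasDerivAt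
        exact h1.comp τ₀ (hPd τ₀)
      have h0 : HasDerivAt (fun τ : ℝ => F y₀ + 2 * K * (τ - τ₀)) (2 * K) τ₀ := by
        have := (((hasDerivAt_id τ₀).sub_const τ₀).const_mul (2 * K)).const_add (F y₀)
        simpa using this
      have h2 := ((h0.div hFP (by rw [hPτ]; exact hF0.ne')).sub_const 1)
      have h3 : HasDerivAt (fun τ => 1 / F (P τ) * (F y₀ + 2 * K * (τ - τ₀)) - 1) _ τ₀ :=
        h2.congr_of_eventuallyEq (Eventually.of_forall fun τ => by simp; ring)
      rw [h3.deriv]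
      simp only [hPτ, sub_self, mul_zero, add_zero]
      apply div_pos _ (by positivity)
      rw [hK]; nlinarith
    · rw [(hqd τ₀ hpos0).deriv, hPτ]
      field_simp; simp
    · exact (hqd τ₀ hpos0).continuousAt
  refine ⟨K, ?_⟩
  filter_upwards [hmin, hPpos] with τ hτ hpτ y hy hyτ
  simp only [hq, hPτ] at hτ
  have : mpG F y ≤ mpG F (P τ) := by rw [← hτ₀] at hτ; linarith
  exact (mpG_mono hF hc).le_iff_le hy hpτ |>.mp this

lemma mp_phi {F : ℝ → ℝ} (hF : ∀ y > 0, 0 < F y) (hc : ∀ y > 0, ContinuousAt F y)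
    {D : Set ℝ} (hD : D.OrdConnected) {φ : ℝ → ℝ} (hφ : DifferentiableOn ℝ φ D)
    (hφmono : StrictMonoOn φ D) (hode : ∀ τ ∈ D, derivWithin φ D τ = F (φ τ))
    {a b : ℝ} (ha : a ∈ D) (hb : b ∈ D) (hab : a ≤ b) (hpos : 0 < φ a) :
    mpG F (φ b) - b = mpG F (φ a) - a := by
  have hsub : Icc a b ⊆ D := hD.out ha hb
  have hp : ∀ x ∈ Icc a b, 0 < φ x := fun x hx =>
    hpos.trans_le (hφmono.monotoneOn ha (hsub hx) hx.1)
  have hd : ∀ x ∈ Icc a b, HasDerivWithinAt (fun x => mpG F (φ x) - x) 0 D x := by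
    intro x hx
    have h1 : HasDerivWithinAt φ (F (φ x)) D x := by
      rw [← hode x (hsub hx)]; exact (hφ x (hsub hx)).hasDerivWithinAt
    have h2 := ((mpG_deriv hF hc (hp x hx)).comp_hasDerivWithinAt x h1).sub (hasDerivWithinAt_id x D)
    refine h2.congr_deriv ?_
    have := (hF _ (hp x hx)).ne'
    field_simp; simp
  refine constant_of_has_deriv_right_zero (f := fun x => mpG F (φ x) - x) (a := a) (b := b) ?_ ?_ b ⟨hab, le_rfl⟩
  · exact fun x hx => ((hd x hx).continuousWithinAt).mono hsub
  · intro x hx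
    refine (hd x ⟨hx.1, hx.2.le⟩).mono_of_mem_nhdsWithin ?_
    refine mem_of_superset (Icc_mem_nhdsGE hx.2) ?_
    exact fun y hy => hsub ⟨hx.1.trans hy.1, hy.2⟩

/-- The barrier. -/
def mpW {n : ℕ} (p ε N t₂ : ℝ) (z : EuclideanSpace ℝ (Fin n)) (x : EuclideanSpace ℝ (Fin n))
    (t : ℝ) : ℝ := ε * (1 + t) * (1 + ‖x - z‖ ^ 2) ^ p + Real.exp (N * (t - t₂))

lemma mpW_continuous {n : ℕ} (p ε N t₂ : ℝ) (z : EuclideanSpace ℝ (Fin n)) :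
    Continuous fun q : EuclideanSpace ℝ (Fin n) × ℝ => mpW p ε N t₂ z q.1 q.2 := by
  unfold mpW
  have : Continuous fun q : EuclideanSpace ℝ (Fin n) × ℝ => (1 + ‖q.1 - z‖ ^ 2) ^ p := by
    apply Continuous.rpow_const (by fun_prop)
    intro q; left; positivity
  fun_prop

lemma mpW_contDiff_x {n : ℕ} (p ε N t₂ : ℝ) (z : EuclideanSpace ℝ (Fin n)) (t : ℝ) :
    ContDiff ℝ 2 fun x => mpW p ε N t₂ z x t := by
  unfold mpW
  have h1 : ContDiff ℝ 2 fun x : EuclideanSpace ℝ (Fin n) => 1 + ‖x - z‖ ^ 2 :=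
    contDiff_const.add ((contDiff_id.sub contDiff_const).norm_sq ℝ)
  have h2 : ContDiff ℝ 2 fun x : EuclideanSpace ℝ (Fin n) => (1 + ‖x - z‖ ^ 2) ^ p :=
    h1.rpow_const_of_ne fun x => by positivity
  exact (contDiff_const.mul h2).add contDiff_const

lemma mpW_contDiff_t {n : ℕ} (p ε N t₂ : ℝ) (z : EuclideanSpace ℝ (Fin n))
    (x : EuclideanSpace ℝ (Fin n)) :
    ContDiff ℝ 1 fun t => mpW p ε N t₂ z x t := by
  unfold mpW
  fun_prop

lemma mpW_deriv_t {n : ℕ} (p ε N t₂ : ℝ) (z : EuclideanSpace ℝ (Fin n))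
    (x : EuclideanSpace ℝ (Fin n)) (t : ℝ) :
    HasDerivAt (fun t => mpW p ε N t₂ z x t)
      (ε * (1 + ‖x - z‖ ^ 2) ^ p + N * Real.exp (N * (t - t₂))) t := by
  unfold mpW
  have h1 := (((hasDerivAt_id t).const_add 1).const_mul ε).mul_const ((1 + ‖x - z‖ ^ 2) ^ p)
  have h2 := (((hasDerivAt_id t).sub_const t₂).const_mul N).exp
  refine (h1.add h2).congr_deriv ?_
  simp; ring

lemma mp_no_max {n : ℕ}
    {H : EuclideanSpace ℝ (Fin n) → Matrix (Fin n) (Fin n) ℝ → ℝ} {k₁ : ℝ}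
    (hH : ConditionsABC n H k₁) (hk₁ : 0 < k₁) {C : ℝ} (hC0 : 0 < C)
    (hC : ∀ (lam : ℝ) (e : EuclideanSpace ℝ (Fin n)), ‖e‖ = 1 → H e (lam • outerProd e + 1) ≤ C)
    {T : ℝ} {f F : ℝ → ℝ} (hF : ∀ y > 0, 0 < F y) (hd : ∀ y > 0, DifferentiableAt ℝ F y)
    (hfF : ∀ y > 0, F y ^ k₁ = f y)
    {u : EuclideanSpace ℝ (Fin n) × ℝ → ℝ}
    (hupos : ∀ (x : EuclideanSpace ℝ (Fin n)), ∀ t ∈ Icc 0 T, 0 < u (x, t))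
    (hsub : ParabolicSubsolution
      (fun _ r q X pt => H q X - f r * pt) (univ ×ˢ Ioo 0 T) u)
    (z : EuclideanSpace ℝ (Fin n)) {p : ℝ} (hp : p = (k₁ + 2) / (2 * k₁))
    {ε N t₂ : ℝ} (hε : 0 < ε) (hN : 0 < N)
    (hεC : C * (2 * p) ^ (k₁ + 1) * (ε * (1 + T)) ^ (k₁ + 1) < ε)
    {x₀ : EuclideanSpace ℝ (Fin n)} {t₀ : ℝ} (ht₀ : t₀ ∈ Ioo 0 T)
    (hmax : ∀ x, ∀ t ∈ Ioo 0 T, mpG F (u (x, t)) - mpW p ε N t₂ z x t ≤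
      mpG F (u (x₀, t₀)) - mpW p ε N t₂ z x₀ t₀) : False := by
  set y₀ := u (x₀, t₀) with hy₀d
  have hy₀ : 0 < y₀ := hupos x₀ t₀ ⟨ht₀.1.le, ht₀.2.le⟩
  have hF0 := hF y₀ hy₀
  obtain ⟨K, hK⟩ := mp_touch hF hd hy₀
  set w₀ := mpW p ε N t₂ z x₀ t₀ with hw₀
  have hp0 : 0 < p := by rw [hp]; positivity
  set ψ : EuclideanSpace ℝ (Fin n) → ℝ → ℝ := fun x t =>
    y₀ + F y₀ * (mpW p ε N t₂ z x t - w₀) + K * (mpW p ε N t₂ z x t - w₀) ^ 2 with hψ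
  have hloc : IsLocalMaxOn (fun q : EuclideanSpace ℝ (Fin n) × ℝ => u q - ψ q.1 q.2)
      (univ ×ˢ Ioo 0 T) (x₀, t₀) := by
    have hcont : Tendsto (fun q : EuclideanSpace ℝ (Fin n) × ℝ =>
        mpG F y₀ + (mpW p ε N t₂ z q.1 q.2 - w₀)) (nhds (x₀, t₀)) (nhds (mpG F y₀)) := by
      have hcc : Continuous (fun q : EuclideanSpace ℝ (Fin n) × ℝ =>
          mpG F y₀ + (mpW p ε N t₂ z q.1 q.2 - w₀)) :=
        continuous_const.add ((mpW_continuous p ε N t₂ z).sub continuous_const)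
      have := hcc.tendsto (x₀, t₀)
      simpa [← hw₀] using this
    have h1 := nhdsWithin_le_nhds (s := (univ ×ˢ Ioo 0 T)) (hcont.eventually hK)
    show ∀ᶠ q in nhdsWithin (x₀, t₀) (univ ×ˢ Ioo 0 T), _
    filter_upwards [h1, self_mem_nhdsWithin] with q hq hqm
    obtain ⟨x, t⟩ := q
    have ht : t ∈ Ioo 0 T := hqm.2
    have hm := hmax x t ht
    have h2 := hq (u (x, t)) (hupos x t ⟨ht.1.le, ht.2.le⟩) (by simp only; linarith)
    simp only [add_sub_cancel_left] at h2
    simp only [hψ, ← hw₀, ← hy₀d, sub_self]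
    simp only [mul_zero, add_zero, ne_eq, OfNat.ofNat_ne_zero, not_false_eq_true, zero_pow, sub_self]
    linarith
  have hcx : ∀ t, ContDiff ℝ 2 fun x => ψ x t := fun t => by
    have := mpW_contDiff_x p ε N t₂ z t
    simp only [hψ]
    fun_prop
  have hct : ∀ x, ContDiff ℝ 1 fun t => ψ x t := fun x => by
    have := mpW_contDiff_t p ε N t₂ z x
    simp only [hψ]
    fun_prop
  have hineq := hsub ψ hcx hct x₀ t₀ ⟨mem_univ _, ht₀⟩ hloc
  simp only [← hy₀d] at hineq
  have hdt : deriv (ψ x₀) t₀ =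
      F y₀ * (ε * (1 + ‖x₀ - z‖ ^ 2) ^ p + N * Real.exp (N * (t₀ - t₂))) := by
    have h1 := (mpW_deriv_t p ε N t₂ z x₀ t₀).sub_const w₀
    have h2 := ((h1.const_mul (F y₀)).const_add y₀).add ((h1.pow 2).const_mul K)
    have h3 : deriv (ψ x₀) t₀ = _ := h2.deriv
    rw [h3, ← hw₀]
    simp
  set b := ε * (1 + t₀) with hb
  have hb0 : 0 < b := mul_pos hε (by linarith [ht₀.1])
  set c := Real.exp (N * (t₀ - t₂)) - w₀ with hc
  set s₀ := 1 + ‖x₀ - z‖ ^ 2 with hs₀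
  have hs1 : 1 ≤ s₀ := by rw [hs₀]; nlinarith [sq_nonneg ‖x₀ - z‖]
  have hs0 : 0 < s₀ := by linarith
  have hbc : b * s₀ ^ p + c = 0 := by
    rw [hc, hw₀, mpW]; ring
  set Q : ℝ → ℝ := fun s => y₀ + F y₀ * (b * s ^ p + c) + K * (b * s ^ p + c) ^ 2 with hQ
  set Q' : ℝ → ℝ := fun s => (F y₀ + 2 * K * (b * s ^ p + c)) * (b * (p * s ^ (p - 1))) with hQ'
  have hQd : ∀ s > 0, HasDerivAt Q (Q' s) s := by
    intro s hs
    have h1 := ((Real.hasDerivAt_rpow_const (p := p) (Or.inl hs.ne')).const_mul b).add_const c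
    have h2 := ((h1.const_mul (F y₀)).const_add y₀).add ((h1.pow 2).const_mul K)
    refine h2.congr_deriv ?_
    simp only [hQ']; push_cast; ring
  have hQ'd : HasDerivAt Q' (deriv Q' s₀) s₀ := by
    apply DifferentiableAt.hasDerivAt
    have h1 : ∀ r : ℝ, DifferentiableAt ℝ (fun s : ℝ => s ^ r) s₀ := fun r =>
      (Real.hasDerivAt_rpow_const (p := r) (Or.inl hs0.ne')).differentiableAt
    have h2 := h1 p
    have h3 := h1 (p - 1)
    simp only [hQ']
    fun_prop
  obtain ⟨hg, hh⟩ := mp_radial Q Q' (deriv Q' s₀) z x₀ hQd hQ'd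
  have hψQ : (fun x => ψ x t₀) = fun x => Q (1 + ‖x - z‖ ^ 2) := by
    funext x
    simp only [hψ, hQ, mpW, hc, hb]; ring
  rw [hψQ, hg, hh, hdt, ← hs₀] at hineq
  have hQ's : Q' s₀ = F y₀ * (b * (p * s₀ ^ (p - 1))) := by
    simp only [hQ', hbc]; ring
  have hα : 0 < 2 * Q' s₀ := by rw [hQ's]; positivity
  have hbd := mp_H_bound hH hk₁ hC (2 * Q' s₀) (4 * deriv Q' s₀) hα (x₀ - z)
  have hαp : (2 * Q' s₀) ^ (k₁ + 1) =
      (f y₀ * F y₀) * ((2 * p) ^ (k₁ + 1) * b ^ (k₁ + 1) * s₀ ^ ((p - 1) * (k₁ + 1))) := by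
    have : 2 * Q' s₀ = F y₀ * ((2 * p) * b * s₀ ^ (p - 1)) := by rw [hQ's]; ring
    rw [this, Real.mul_rpow (by positivity) (by positivity),
      Real.mul_rpow (by positivity) (by positivity), Real.mul_rpow (by positivity) (by positivity),
      ← Real.rpow_mul hs0.le, Real.rpow_add_one hF0.ne', hfF y₀ hy₀]
  have hr : ‖x₀ - z‖ ^ k₁ ≤ s₀ ^ (k₁ / 2) := by
    have : ‖x₀ - z‖ ^ k₁ = (‖x₀ - z‖ ^ 2) ^ (k₁ / 2) := by
      rw [← Real.rpow_natCast, ← Real.rpow_mul (norm_nonneg _)]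
      congr 1; push_cast; ring
    rw [this]
    exact Real.rpow_le_rpow (by positivity) (by rw [hs₀]; linarith) (by positivity)
  have hexp : s₀ ^ ((p - 1) * (k₁ + 1)) * s₀ ^ (k₁ / 2) = s₀ ^ p := by
    rw [← Real.rpow_add hs0]
    congr 1; rw [hp]; field_simp; ring
  have hbT : b ^ (k₁ + 1) ≤ (ε * (1 + T)) ^ (k₁ + 1) := by
    apply Real.rpow_le_rpow hb0.le _ (by positivity)
    rw [hb]
    exact mul_le_mul_of_nonneg_left (by linarith [ht₀.2]) hε.le
  have hf0 : 0 < f y₀ := by rw [← hfF y₀ hy₀]; positivity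
  have hfin : C * (2 * Q' s₀) ^ (k₁ + 1) * ‖x₀ - z‖ ^ k₁ ≤ (f y₀ * F y₀) * (ε * s₀ ^ p) := by
    calc C * (2 * Q' s₀) ^ (k₁ + 1) * ‖x₀ - z‖ ^ k₁
        ≤ C * (2 * Q' s₀) ^ (k₁ + 1) * s₀ ^ (k₁ / 2) := by gcongr
      _ = (f y₀ * F y₀) * ((C * (2 * p) ^ (k₁ + 1) * b ^ (k₁ + 1)) * s₀ ^ p) := by
          rw [hαp, ← hexp]; ring
      _ ≤ (f y₀ * F y₀) * ((C * (2 * p) ^ (k₁ + 1) * (ε * (1 + T)) ^ (k₁ + 1)) * s₀ ^ p) := by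
          gcongr
      _ ≤ _ := by gcongr
  have hE : 0 < (f y₀ * F y₀) * (N * Real.exp (N * (t₀ - t₂))) := by positivity
  nlinarith


/-- **Theorem 2.8(a)** (maximum principle for the doubly nonlinear equation
`H(Du,D²u) - f(u)u_t = 0`, case `k = k₁ + 1 > 1`). Here `γ = k₁ + 2 > 2` and
`γ* = γ/(γ-2) = (k₁+2)/k₁`; `φ` is a C² increasing nonnegative function on an interval `D`
unbounded above with `φ' = f(φ)^{1/(k-1)}`. -/
theorem maximum_principle_doubly_nonlinear
    (n : ℕ) (hn : 2 ≤ n)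
    (H : EuclideanSpace ℝ (Fin n) → Matrix (Fin n) (Fin n) ℝ → ℝ) (k₁ : ℝ)
    (hH : ConditionsABC n H k₁) (hk₁ : 0 < k₁)
    (hΛ : LambdaSupFinite n H)
    (T : ℝ) (hT : 0 < T)
    (f : ℝ → ℝ) (hf1 : ContDiffOn ℝ 1 f (Ici 0)) (hfmono : StrictMonoOn f (Ici 0))
    (hfnonneg : ∀ s ∈ Ici (0:ℝ), 0 ≤ f s)
    (hfconc : ConcaveOn ℝ (Ici 0) fun s => f s ^ (1 / k₁))
    (g : EuclideanSpace ℝ (Fin n) → ℝ) (hgcont : Continuous g)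
    (hgpos : ∃ c > (0:ℝ), ∀ x, c ≤ g x) (hgbdd : BddAbove (Set.range g))
    (D : Set ℝ) (hD : D.OrdConnected) (hDunbdd : ¬ BddAbove D)
    (φ : ℝ → ℝ) (hφsmooth : ContDiffOn ℝ 2 φ D) (hφmono : StrictMonoOn φ D)
    (hφnonneg : ∀ τ ∈ D, 0 ≤ φ τ)
    (hφode : ∀ τ ∈ D, derivWithin φ D τ = f (φ τ) ^ (1 / k₁))
    (u : EuclideanSpace ℝ (Fin n) × ℝ → ℝ)
    (husc : UpperSemicontinuousOn u (univ ×ˢ Icc 0 T))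
    (hupos : ∀ (x : EuclideanSpace ℝ (Fin n)), ∀ t ∈ Icc 0 T, 0 < u (x, t))
    (hsub : ParabolicSubsolution
      (fun _ r q X pt => H q X - f r * pt) (univ ×ˢ Ioo 0 T) u)
    (hinit : ∀ x, u (x, 0) ≤ g x)
    (z : EuclideanSpace ℝ (Fin n))
    (hgrow : ∃ ρ : ℝ → ℝ,
      Tendsto (fun R => ρ R / R ^ ((k₁ + 2) / k₁)) atTop (nhds 0) ∧
      ∀ᶠ R in atTop, ρ R ∈ D ∧ ∀ (x : EuclideanSpace ℝ (Fin n)) (t : ℝ),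
        ‖x - z‖ ≤ R → t ∈ Ioo 0 T → u (x, t) ≤ φ (ρ R)) :
    ∀ (x : EuclideanSpace ℝ (Fin n)), ∀ t ∈ Ioo 0 T, u (x, t) ≤ ⨆ y, g y := by
  have hfpos : ∀ y > 0, 0 < f y := fun y hy =>
    (hfnonneg 0 self_mem_Ici).trans_lt (hfmono self_mem_Ici (mem_Ici.mpr (le_of_lt hy)) hy)
  set F : ℝ → ℝ := fun s => f s ^ (1 / k₁) with hFdef
  have hF : ∀ y > 0, 0 < F y := fun y hy => Real.rpow_pos_of_pos (hfpos y hy) _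
  have hd : ∀ y > 0, DifferentiableAt ℝ F y := fun y hy => by
    have h1 : DifferentiableAt ℝ f y :=
      (hf1.differentiableOn (by norm_num)).differentiableAt (Ici_mem_nhds hy)
    exact h1.rpow_const (Or.inl (hfpos y hy).ne')
  have hc : ∀ y > 0, ContinuousAt F y := fun y hy => (hd y hy).continuousAt
  have hfF : ∀ y > 0, F y ^ k₁ = f y := fun y hy => by
    simp only [hFdef]
    rw [← Real.rpow_mul (hfpos y hy).le, one_div, inv_mul_cancel₀ hk₁.ne', Real.rpow_one]
  obtain ⟨C', hC'⟩ := hΛ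
  obtain ⟨C, hC0, hC⟩ : ∃ C : ℝ, 0 < C ∧ ∀ (lam : ℝ) (e : EuclideanSpace ℝ (Fin n)), ‖e‖ = 1 →
      H e (lam • outerProd e + 1) ≤ C :=
    ⟨max C' 1, by positivity, fun l e he => (hC' l e he).trans (le_max_left _ _)⟩
  obtain ⟨ρ, hρ, hgr⟩ := hgrow
  have hGm := mpG_mono hF hc
  -- base point
  obtain ⟨R₁, hR₁⟩ := (hgr.and (eventually_ge_atTop 0)).exists
  set τb := ρ R₁ with hτb
  have hτbD : τb ∈ D := hR₁.1.1
  have hτbpos : 0 < φ τb := by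
    have ht : T / 2 ∈ Ioo 0 T := ⟨by linarith, by linarith⟩
    exact (hupos z (T / 2) ⟨ht.1.le, ht.2.le⟩).trans_le
      (hR₁.1.2 z (T / 2) (by simpa using hR₁.2) ht)
  set c₀ := mpG F (φ τb) - τb with hc₀
  have hGφ : ∀ τ ∈ D, 0 < φ τ → mpG F (φ τ) = τ + c₀ := by
    intro τ hτ hpos
    have hφd := hφsmooth.differentiableOn (by norm_num)
    rcases le_total τ τb with h | h
    · have := mp_phi hF hc hD hφd hφmono hφode hτ hτbD h hpos
      linarith
    · have := mp_phi hF hc hD hφd hφmono hφode hτbD hτ h hτbpos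
      linarith
  have hgrG : ∀ᶠ R in atTop, ∀ (x : EuclideanSpace ℝ (Fin n)) (t : ℝ),
        ‖x - z‖ ≤ R → t ∈ Ioo 0 T → mpG F (u (x, t)) ≤ ρ R + c₀ := by
    filter_upwards [hgr] with R hR x t hx ht
    have h1 := hR.2 x t hx ht
    have h0 := hupos x t ⟨ht.1.le, ht.2.le⟩
    rw [← hGφ _ hR.1 (h0.trans_le h1)]
    exact hGm.monotoneOn h0 (h0.trans_le h1) h1
  intro x₁ t₁ ht₁
  set M := ⨆ y, g y with hM
  have hgM : ∀ x, g x ≤ M := fun x => le_ciSup hgbdd x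
  have hM0 : 0 < M := by
    obtain ⟨c, hc, hcg⟩ := hgpos
    exact hc.trans_le ((hcg z).trans (hgM z))
  by_contra hcon
  push Not at hcon
  set δ := mpG F (u (x₁, t₁)) - mpG F M with hδ
  have hδ0 : 0 < δ := sub_pos.mpr (hGm hM0 (hM0.trans hcon) hcon)
  obtain ⟨p, hp⟩ : ∃ p, p = (k₁ + 2) / (2 * k₁) := ⟨_, rfl⟩
  have hp0 : 0 < p := by rw [hp]; positivity
  -- choice of ε
  obtain ⟨ε, hε, hεδ, hεC⟩ : ∃ ε > 0, ε * (1 + t₁) * (1 + ‖x₁ - z‖ ^ 2) ^ p < δ / 2 ∧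
      C * (2 * p) ^ (k₁ + 1) * (ε * (1 + T)) ^ (k₁ + 1) < ε := by
    have h1 : Tendsto (fun ε : ℝ => ε * (1 + t₁) * (1 + ‖x₁ - z‖ ^ 2) ^ p)
        (nhdsWithin 0 (Ioi 0)) (nhds 0) := by
      have : Continuous (fun ε : ℝ => ε * (1 + t₁) * (1 + ‖x₁ - z‖ ^ 2) ^ p) := by fun_prop
      have := (this.tendsto 0).mono_left (nhdsWithin_le_nhds (s := Ioi 0))
      simpa using this
    have h2 : Tendsto (fun ε : ℝ => (C * (2 * p) ^ (k₁ + 1) * (1 + T) ^ (k₁ + 1)) * ε ^ k₁)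
        (nhdsWithin 0 (Ioi 0)) (nhds 0) := by
      have : Continuous (fun ε : ℝ => (C * (2 * p) ^ (k₁ + 1) * (1 + T) ^ (k₁ + 1)) * ε ^ k₁) :=
        continuous_const.mul (Real.continuous_rpow_const hk₁.le)
      have := (this.tendsto 0).mono_left (nhdsWithin_le_nhds (s := Ioi 0))
      simpa [Real.zero_rpow hk₁.ne'] using this
    obtain ⟨ε, ⟨ha, hb⟩, hε⟩ := (((h1.eventually (gt_mem_nhds (half_pos hδ0))).and
      (h2.eventually (gt_mem_nhds one_pos))).and self_mem_nhdsWithin).exists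
    have hε : 0 < ε := hε
    refine ⟨ε, hε, ha, ?_⟩
    rw [Real.mul_rpow hε.le (by linarith), Real.rpow_add_one hε.ne']
    calc _ = (C * (2 * p) ^ (k₁ + 1) * (1 + T) ^ (k₁ + 1) * ε ^ k₁) * ε := by ring
      _ < 1 * ε := mul_lt_mul_of_pos_right hb hε
      _ = ε := one_mul ε
  -- choice of R₀
  have hRbig : ∀ᶠ R in atTop, ρ R + c₀ ≤ mpG F M + ε * R ^ ((k₁ + 2) / k₁) := by
    have hlim : Tendsto (fun R : ℝ => R ^ ((k₁ + 2) / k₁)) atTop atTop :=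
      tendsto_rpow_atTop (by positivity)
    have h1 := hρ.eventually (gt_mem_nhds (half_pos hε))
    have h2 := hlim.eventually (eventually_ge_atTop ((c₀ - mpG F M) / (ε / 2)))
    filter_upwards [h1, h2, eventually_gt_atTop 0] with R a1 a2 a3
    have hRp : 0 < R ^ ((k₁ + 2) / k₁) := Real.rpow_pos_of_pos a3 _
    rw [div_lt_iff₀ hRp] at a1
    rw [div_le_iff₀ (half_pos hε)] at a2
    linarith
  obtain ⟨R₂, hR₂⟩ := eventually_atTop.mp (hgrG.and hRbig)
  set R₀ := max R₂ (max ‖x₁ - z‖ 0) with hR₀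
  have hR₀2 : R₂ ≤ R₀ := le_max_left _ _
  have hx₁R : ‖x₁ - z‖ ≤ R₀ := (le_max_left _ _).trans (le_max_right _ _)
  -- choice of N
  set d := (T - t₁) / 3 with hdd
  have hd0 : 0 < d := by rw [hdd]; linarith [ht₁.2]
  set t₂ := t₁ + d with ht₂
  obtain ⟨N, hN, hN1, hN2⟩ : ∃ N > 0, Real.exp (N * (t₁ - t₂)) < δ / 2 ∧
      ρ R₀ + c₀ - mpG F M ≤ Real.exp (N * d) := by
    have h1 : Tendsto (fun N : ℝ => Real.exp (N * d)) atTop atTop :=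
      Real.tendsto_exp_atTop.comp (tendsto_id.atTop_mul_const hd0)
    have h2 := h1.inv_tendsto_atTop
    obtain ⟨N, ⟨ha, hb⟩, hN⟩ := (((h1.eventually (eventually_ge_atTop (ρ R₀ + c₀ - mpG F M))).and
      (h2.eventually (gt_mem_nhds (half_pos hδ0)))).and (eventually_gt_atTop 0)).exists
    refine ⟨N, hN, ?_, ha⟩
    have : N * (t₁ - t₂) = -(N * d) := by rw [ht₂]; ring
    rw [this, Real.exp_neg]
    exact hb
  set W := mpW p ε N t₂ z with hW
  set m : EuclideanSpace ℝ (Fin n) × ℝ → ℝ := fun q => mpG F (u q) - W q.1 q.2 with hm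
  have hm1 : mpG F M < m (x₁, t₁) := by
    simp only [hm, hW, mpW]; linarith
  have hWpos : ∀ x, ∀ t, 0 ≤ t → ε * ((1 + ‖x - z‖ ^ 2) ^ p) + Real.exp (N * (t - t₂)) ≤ W x t := by
    intro x t ht
    simp only [hW, mpW]
    have : 0 < (1 + ‖x - z‖ ^ 2) ^ p := by positivity
    have h2 : 0 ≤ ε * t * (1 + ‖x - z‖ ^ 2) ^ p := by positivity
    linarith
  set T' := t₂ + d with hT'
  have hT'T : T' < T := by rw [hT', ht₂, hdd]; linarith [ht₁.2]
  have hT'0 : t₁ < T' := by rw [hT', ht₂]; linarith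
  -- outside the compact set
  have hout : ∀ x, ∀ t ∈ Ioo 0 T, (R₀ < ‖x - z‖ ∨ T' < t) → m (x, t) ≤ mpG F M := by
    intro x t ht hor
    have hw := hWpos x t ht.1.le
    have hE := Real.exp_pos (N * (t - t₂))
    by_cases hxR : R₀ < ‖x - z‖
    · obtain ⟨h1, h2⟩ := hR₂ ‖x - z‖ (hR₀2.trans hxR.le)
      have h3 := h1 x t le_rfl ht
      have h4 : ‖x - z‖ ^ ((k₁ + 2) / k₁) ≤ (1 + ‖x - z‖ ^ 2) ^ p := by
        have : ‖x - z‖ ^ ((k₁ + 2) / k₁) = (‖x - z‖ ^ 2) ^ p := by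
          rw [← Real.rpow_natCast, ← Real.rpow_mul (norm_nonneg _)]
          congr 1; rw [hp]; push_cast; field_simp
        rw [this]
        exact Real.rpow_le_rpow (by positivity) (by linarith) hp0.le
      have h5 := mul_le_mul_of_nonneg_left h4 hε.le
      simp only [hm]; linarith
    · have htT : T' < t := hor.resolve_left hxR
      have h3 := (hR₂ R₀ hR₀2).1 x t (not_lt.mp hxR) ht
      have h4 : Real.exp (N * d) ≤ Real.exp (N * (t - t₂)) := by
        apply Real.exp_le_exp.mpr
        apply mul_le_mul_of_nonneg_left _ hN.le
        rw [hT'] at htT; linarith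
      have h6 : 0 < ε * ((1 + ‖x - z‖ ^ 2) ^ p) := by positivity
      simp only [hm]; linarith
  have h0 : ∀ x, m (x, 0) ≤ mpG F M := by
    intro x
    have hw := hWpos x 0 le_rfl
    have hE := Real.exp_pos (N * (0 - t₂))
    have h6 : 0 < ε * ((1 + ‖x - z‖ ^ 2) ^ p) := by positivity
    have hu0 := hupos x 0 ⟨le_rfl, hT.le⟩
    have := hGm.monotoneOn hu0 hM0 ((hinit x).trans (hgM x))
    simp only [hm]; linarith
  -- maximum
  have hKc : IsCompact (Metric.closedBall z R₀ ×ˢ Icc 0 T') :=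
    (isCompact_closedBall z R₀).prod isCompact_Icc
  have hmusc : UpperSemicontinuousOn m (Metric.closedBall z R₀ ×ˢ Icc 0 T') := by
    have h1 : UpperSemicontinuousOn (fun q => mpG F (u q)) (Metric.closedBall z R₀ ×ˢ Icc 0 T') := by
      rintro ⟨x, t⟩ hq c hcq
      have hsubset : Metric.closedBall z R₀ ×ˢ Icc 0 T' ⊆ univ ×ˢ Icc 0 T := by
        rintro ⟨x, t⟩ ⟨_, ht⟩
        exact ⟨mem_univ _, ht.1, ht.2.trans hT'T.le⟩
      have hu := hupos x t (hsubset hq).2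
      have hev := (mpG_deriv hF hc hu).continuousAt.eventually (gt_mem_nhds hcq)
      obtain ⟨y, hy, hyu⟩ := ((hev.filter_mono nhdsWithin_le_nhds).and
        (self_mem_nhdsWithin (s := Ioi (u (x, t))))).exists
      have hyu : u (x, t) < y := hyu
      have h2 := (husc.mono hsubset) (x, t) hq y hyu
      filter_upwards [h2, self_mem_nhdsWithin] with q' hq' hq'm
      have hu' := hupos q'.1 q'.2 (hsubset hq'm).2
      exact (hGm.monotoneOn hu' (hu.trans hyu) (le_of_lt hq')).trans_lt hy
    have h2 : UpperSemicontinuousOn (fun q : EuclideanSpace ℝ (Fin n) × ℝ => - W q.1 q.2)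
        (Metric.closedBall z R₀ ×ˢ Icc 0 T') :=
      ((mpW_continuous p ε N t₂ z).neg.upperSemicontinuous).upperSemicontinuousOn _
    have h3 := h1.add h2
    simpa only [hm, sub_eq_add_neg] using h3
  have hmem : (x₁, t₁) ∈ Metric.closedBall z R₀ ×ˢ Icc 0 T' :=
    ⟨by simpa [dist_eq_norm] using hx₁R, ht₁.1.le, hT'0.le⟩
  obtain ⟨⟨x₀, t₀⟩, hq₀, hq₀max⟩ := hmusc.exists_isMaxOn ⟨_, hmem⟩ hKc
  have hbig : mpG F M < m (x₀, t₀) := hm1.trans_le (hq₀max hmem)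
  have ht₀ : t₀ ∈ Ioo 0 T := by
    refine ⟨lt_of_le_of_ne hq₀.2.1 ?_, hq₀.2.2.trans_lt hT'T⟩
    intro h
    rw [← h] at hbig
    exact absurd (h0 x₀) (not_le.mpr hbig)
  refine mp_no_max hH hk₁ hC0 hC hF hd hfF hupos hsub z hp hε hN hεC ht₀ (x₀ := x₀) (t₂ := t₂) ?_
  intro x t ht
  show m (x, t) ≤ m (x₀, t₀)
  by_cases hin : R₀ < ‖x - z‖ ∨ T' < t
  · exact (hout x t ht hin).trans hbig.le
  · push Not at hin
    exact hq₀max (show (x, t) ∈ _ from ⟨by simpa [dist_eq_norm] using hin.1, ht.1.le, hin.2⟩)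
end
end

section
/- Minimum principle for doubly nonlinear equations, convergent integral case (Theorem 2.8(b), case (2.71.0)(i)): Suppose H satisfies Conditions A–C with k₁ > 0 (so k > 1) and Λ^sup < ∞. Let f : [0,∞) → [0,∞) be a C¹ increasing function with f(s) > 0 for s > 0 and such that s ↦ f(s)^{1/(k−1)} is concave, and suppose that ∫₀¹ f(θ)^{−1/(k−1)} dθ < ∞ (that is, for a primitive F of f^{−1/(k−1)} on (0,∞), lim_{ε→0⁺}(F(1) − F(ε)) < ∞). Let g : ℝⁿ → (0,∞) be continuous with 0 < inf_{ℝⁿ} g ≤ sup_{ℝⁿ} g < ∞. If u is lower semicontinuous on the closure of ℝⁿ_T with u > 0, a viscosity supersolution of H(Du, D²u) − f(u)u_t = 0 in ℝⁿ_T, and u(x,0) ≥ g(x) for all x ∈ ℝⁿ, then u(x,t) ≥ inf_{ℝⁿ} g for all (x,t) ∈ ℝⁿ_T (no growth condition at infinity is required). -/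
open Set MeasureTheory

noncomputable section

lemma quad_fderiv {n : ℕ} (c0 c : ℝ) (z y v : EuclideanSpace ℝ (Fin n)) :
    fderiv ℝ (fun x : EuclideanSpace ℝ (Fin n) => c0 + c * ‖x - z‖ ^ 2) y v
      = 2 * c * inner ℝ (y - z) v := by
  have h1 : HasFDerivAt (fun x : EuclideanSpace ℝ (Fin n) => x - z)
      (ContinuousLinearMap.id ℝ _) y := (hasFDerivAt_id y).sub_const z
  have h2 := ((h1.norm_sq).const_mul c).const_add c0
  rw [h2.fderiv]
  simp [inner_sub_left]
  ring

lemma quad_grad {n : ℕ} (c0 c : ℝ) (z y : EuclideanSpace ℝ (Fin n)) :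
    spaceGrad (fun x : EuclideanSpace ℝ (Fin n) => c0 + c * ‖x - z‖ ^ 2) y
      = (2 * c) • (y - z) := by
  ext i
  simp only [spaceGrad, quad_fderiv, EuclideanSpace.inner_single_right]
  simp

lemma quad_hess {n : ℕ} (c0 c : ℝ) (z y : EuclideanSpace ℝ (Fin n)) :
    spaceHess (fun x : EuclideanSpace ℝ (Fin n) => c0 + c * ‖x - z‖ ^ 2) y
      = (2 * c) • (1 : Matrix (Fin n) (Fin n) ℝ) := by
  ext i j
  simp only [spaceHess, quad_fderiv, EuclideanSpace.inner_single_right, Matrix.of_apply]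
  have h1 : HasFDerivAt (fun x : EuclideanSpace ℝ (Fin n) => (x - z) j)
      (EuclideanSpace.proj j : EuclideanSpace ℝ (Fin n) →L[ℝ] ℝ) y := by
    have := ((EuclideanSpace.proj j : EuclideanSpace ℝ (Fin n) →L[ℝ] ℝ).hasFDerivAt
      (x := y)).sub_const (z j)
    simpa using this
  have h2 : HasFDerivAt (fun x : EuclideanSpace ℝ (Fin n) =>
      2 * c * (1 * (starRingEnd ℝ) ((x - z) j)))
      ((2 * c) • (EuclideanSpace.proj j : EuclideanSpace ℝ (Fin n) →L[ℝ] ℝ)) y := by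
    simpa using h1.const_mul (2 * c)
  rw [h2.fderiv]
  simp [Matrix.one_apply, Pi.single_apply, eq_comm]

/-- Existence of the primitive `F` of `f^{-1/k₁}`, with the properties used in the proof. -/
lemma exists_primitive (k₁ : ℝ) (hk₁ : 0 < k₁) (f : ℝ → ℝ)
    (hfmono : StrictMonoOn f (Ici 0)) (hfpos : ∀ s : ℝ, 0 < s → 0 < f s)
    (hfint : IntegrableOn (fun θ : ℝ => f θ ^ (-(1 / k₁))) (Ioo (0:ℝ) 1)) :
    ∃ F : ℝ → ℝ, Continuous F ∧ Monotone F ∧ F 0 = 0 ∧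
      ∀ s s₀, 0 < s → 0 < s₀ → F s - F s₀ ≤ (f s₀ ^ (1 / k₁))⁻¹ * (s - s₀) := by
  set e : ℝ → ℝ := fun θ => f θ ^ (-(1 / k₁)) with he
  have hanti : AntitoneOn e (Ioi 0) := by
    intro a ha b hb hab
    apply Real.rpow_le_rpow_of_nonpos (hfpos a ha)
    · exact hfmono.monotoneOn (mem_Ici.2 (le_of_lt ha)) (mem_Ici.2 (le_of_lt hb)) hab
    · have : 0 < 1 / k₁ := by positivity
      linarith
  have hepos : ∀ θ, 0 < θ → 0 < e θ := fun θ h => Real.rpow_pos_of_pos (hfpos θ h) _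
  set h : ℝ → ℝ := (Ioi (0:ℝ)).indicator e with hh
  have hnn : ∀ θ, 0 ≤ h θ := fun θ =>
    Set.indicator_nonneg (fun x hx => (hepos x hx).le) θ
  have hh_eq : ∀ θ, 0 < θ → h θ = e θ := fun θ hθ => Set.indicator_of_mem (by exact hθ) _
  have hanti' : AntitoneOn h (Ioi 0) := by
    intro a ha b hb hab
    rw [hh_eq a ha, hh_eq b hb]; exact hanti ha hb hab
  have i1 : IntervalIntegrable h volume 0 1 := by
    rw [intervalIntegrable_iff_integrableOn_Ioo_of_le zero_le_one]
    exact hfint.congr_fun (fun x hx => (hh_eq x hx.1).symm) measurableSet_Ioo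
  have i2 : ∀ b, 0 < b → IntervalIntegrable h volume 1 b := by
    intro b hb
    apply AntitoneOn.intervalIntegrable
    apply hanti'.mono
    intro x hx
    exact lt_of_lt_of_le (lt_min one_pos hb) hx.1
  have i3 : ∀ b, IntervalIntegrable h volume 0 b := by
    intro b
    rcases lt_or_ge 0 b with hb | hb
    · exact i1.trans (i2 b hb)
    · have : IntervalIntegrable (fun _ : ℝ => (0:ℝ)) volume 0 b := by simp
      apply this.congr
      intro x hx
      rw [uIoc_of_ge hb] at hx
      exact (Set.indicator_of_notMem (by simpa using hx.2) _).symm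
  have i4 : ∀ a b, IntervalIntegrable h volume a b := fun a b => (i3 a).symm.trans (i3 b)
  have hsub : ∀ a b, (∫ θ in (0:ℝ)..b, h θ) - (∫ θ in (0:ℝ)..a, h θ) = ∫ θ in a..b, h θ :=
    fun a b => intervalIntegral.integral_interval_sub_left (i3 b) (i3 a)
  refine ⟨fun s => ∫ θ in (0:ℝ)..s, h θ, intervalIntegral.continuous_primitive i4 0, ?_, by simp, ?_⟩
  · intro a b hab
    have := intervalIntegral.integral_nonneg (μ := volume) hab (fun x _ => hnn x)
    have h2 := hsub a b
    simp only
    linarith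
  · intro s s₀ hs hs₀
    have hk : (f s₀ ^ (1 / k₁))⁻¹ = h s₀ := by
      rw [hh_eq s₀ hs₀, he]
      exact (Real.rpow_neg (hfpos s₀ hs₀).le _).symm
    simp only
    rw [hsub, hk]
    rcases le_total s₀ s with hle | hle
    · have := intervalIntegral.integral_mono_on hle (i4 s₀ s) (by simp)
        (g := fun _ => h s₀) (fun x hx => hanti' hs₀ (lt_of_lt_of_le hs₀ hx.1) hx.1)
      simp at this
      linarith
    · have := intervalIntegral.integral_mono_on hle (f := fun _ => h s₀) (by simp) (i4 s s₀)
        (fun x hx => hanti' (lt_of_lt_of_le hs hx.1) hs₀ hx.2)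
      simp at this
      rw [intervalIntegral.integral_symm]
      linarith

set_option maxHeartbeats 1600000

/-- **Theorem 2.8(b), convergent-integral case** (minimum principle for the doubly nonlinear
equation `H(Du,D²u) - f(u)u_t = 0`, `k = k₁ + 1 > 1`, when `∫₀¹ f(θ)^{-1/(k-1)} dθ < ∞`).
No growth condition at infinity is required. -/
theorem minimum_principle_doubly_nonlinear_convergent
    (n : ℕ) (hn : 2 ≤ n)
    (H : EuclideanSpace ℝ (Fin n) → Matrix (Fin n) (Fin n) ℝ → ℝ) (k₁ : ℝ)
    (hH : ConditionsABC n H k₁) (hk₁ : 0 < k₁)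
    (hΛ : LambdaSupFinite n H)
    (T : ℝ) (hT : 0 < T)
    (f : ℝ → ℝ) (hf1 : ContDiffOn ℝ 1 f (Ici 0)) (hfmono : StrictMonoOn f (Ici 0))
    (hfnonneg : ∀ s ∈ Ici (0:ℝ), 0 ≤ f s) (hfpos : ∀ s : ℝ, 0 < s → 0 < f s)
    (hfconc : ConcaveOn ℝ (Ici 0) fun s => f s ^ (1 / k₁))
    (hfint : IntegrableOn (fun θ : ℝ => f θ ^ (-(1 / k₁))) (Ioo (0:ℝ) 1))
    (g : EuclideanSpace ℝ (Fin n) → ℝ) (hgcont : Continuous g)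
    (hgpos : ∃ c > (0:ℝ), ∀ x, c ≤ g x) (hgbdd : BddAbove (Set.range g))
    (u : EuclideanSpace ℝ (Fin n) × ℝ → ℝ)
    (hlsc : LowerSemicontinuousOn u (univ ×ˢ Icc 0 T))
    (hupos : ∀ (x : EuclideanSpace ℝ (Fin n)), ∀ t ∈ Icc 0 T, 0 < u (x, t))
    (hsuper : ParabolicSupersolution
      (fun _ r q X pt => H q X - f r * pt) (univ ×ˢ Ioo 0 T) u)
    (hinit : ∀ x, g x ≤ u (x, 0)) :
    ∀ (x : EuclideanSpace ℝ (Fin n)), ∀ t ∈ Ioo 0 T, (⨅ y, g y) ≤ u (x, t) := by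
  obtain ⟨F, hFc, hFm, hF0, hFconc⟩ := exists_primitive k₁ hk₁ f hfmono hfpos hfint
  intro z t₁ ht₁
  by_contra! hlt
  set m : ℝ := ⨅ y, g y with hm
  have hmg : ∀ x, m ≤ g x := by
    obtain ⟨c, _, hc⟩ := hgpos
    exact fun x => ciInf_le ⟨c, by rintro _ ⟨y, rfl⟩; exact hc y⟩ x
  have hu1 : 0 < u (z, t₁) := hupos z t₁ ⟨ht₁.1.le, ht₁.2.le⟩
  have hmpos : 0 < m := hu1.trans hlt
  have hFlt : F (u (z, t₁)) < F m := by
    have h1 := hFconc _ m hu1 hmpos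
    have h2 : 0 < (f m ^ (1 / k₁))⁻¹ := inv_pos.2 (Real.rpow_pos_of_pos (hfpos m hmpos) _)
    have h3 : (f m ^ (1 / k₁))⁻¹ * (u (z, t₁) - m) < 0 :=
      mul_neg_of_pos_of_neg h2 (by linarith)
    linarith
  have hFnn : ∀ s, 0 < s → 0 ≤ F s := fun s hs => hF0 ▸ hFm hs.le
  set M : ℝ := F m with hM
  have hMpos : 0 < M := lt_of_le_of_lt (hFnn _ hu1) hFlt
  set δ : ℝ := M - F (u (z, t₁)) with hδ
  have hδpos : 0 < δ := by simp only [hδ]; linarith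
  set a : ℝ := δ / (4 * T) with ha
  have hapos : 0 < a := by positivity
  have hat : a * t₁ < δ / 4 := by
    have : a * t₁ < a * T := by gcongr; exact ht₁.2
    have h2 : a * T = δ / 4 := by rw [ha]; field_simp
    linarith
  -- choice of the exponent
  obtain ⟨N, hN⟩ : ∃ N : ℕ, (t₁ / T) ^ N < δ / (4 * M) :=
    exists_pow_lt_of_lt_one (by positivity) ((div_lt_one hT).2 ht₁.2)
  have hN' : M * (t₁ / T) ^ (N + 1) < δ / 4 := by
    have h0 : 0 < t₁ / T := div_pos ht₁.1 hT
    have h1 : (t₁ / T) ^ (N + 1) ≤ (t₁ / T) ^ N :=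
      pow_le_pow_of_le_one h0.le ((div_lt_one hT).2 ht₁.2).le (Nat.le_succ N)
    have h2 : M * (t₁ / T) ^ (N + 1) < M * (δ / (4 * M)) := by
      apply mul_lt_mul_of_pos_left (lt_of_le_of_lt h1 hN) hMpos
    have h3 : M * (δ / (4 * M)) = δ / 4 := by field_simp
    linarith
  -- lower bound of `H(·, -I)` on the unit ball
  obtain ⟨C, hC0, hC⟩ : ∃ C : ℝ, 0 ≤ C ∧ ∀ y : EuclideanSpace ℝ (Fin n), ‖y‖ ≤ 1 →
      -C ≤ H y (-1) := by
    have hc : Continuous fun y : EuclideanSpace ℝ (Fin n) => H y (-1) :=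
      hH.continuous.comp (continuous_id.prodMk continuous_const)
    obtain ⟨B, hB⟩ := (isCompact_closedBall (0 : EuclideanSpace ℝ (Fin n)) 1).exists_bound_of_continuousOn
      hc.continuousOn
    refine ⟨|B|, abs_nonneg _, fun y hy => ?_⟩
    have h1 := hB y (by simpa using hy)
    have h2 := neg_abs_le (H y (-1))
    rw [Real.norm_eq_abs] at h1
    have := le_abs_self B
    linarith
  -- choice of the radius
  set R : ℝ := 1 + 2 * M + 2 * M * C / a with hR
  have hq : 0 ≤ 2 * M * C / a := by positivity
  have hR1 : 1 ≤ R := by rw [hR]; linarith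
  have hR2 : 2 * M ≤ R := by rw [hR]; linarith
  have hR3 : 2 * M * C < a * R := by
    have : a * R = a * (1 + 2 * M) + 2 * M * C := by rw [hR]; field_simp
    have : 0 < a * (1 + 2 * M) := by positivity
    linarith
  have hRpos : 0 < R := by linarith
  set b : ℝ := M / R ^ 2 with hb
  have hbpos : 0 < b := by positivity
  have hbR : b * R ^ 2 = M := by rw [hb]; field_simp
  -- the barrier
  set τ : ℝ → ℝ := fun t => M - a * t - M * (t / T) ^ (N + 1) with hτ
  set w : EuclideanSpace ℝ (Fin n) × ℝ → ℝ := fun p => τ p.2 - b * ‖p.1 - z‖ ^ 2 with hw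
  have hτc : ContDiff ℝ 1 τ := by rw [hτ]; fun_prop
  have hwc : Continuous w := by
    have := hτc.continuous
    rw [hw]; fun_prop
  have hcomp : IsCompact (Metric.closedBall z R ×ˢ Icc (0:ℝ) T) :=
    (isCompact_closedBall z R).prod isCompact_Icc
  have hlsc2 : LowerSemicontinuousOn (fun p => F (u p) - w p)
      (Metric.closedBall z R ×ˢ Icc (0:ℝ) T) := by
    have h1 : LowerSemicontinuousOn (F ∘ u) (Metric.closedBall z R ×ˢ Icc (0:ℝ) T) :=
      hFc.comp_lowerSemicontinuousOn (hlsc.mono (prod_mono (subset_univ _) le_rfl)) hFm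
    have h2 := h1.add (hwc.neg.lowerSemicontinuous.lowerSemicontinuousOn _)
    simpa [sub_eq_add_neg] using h2
  have hmem1 : (z, t₁) ∈ Metric.closedBall z R ×ˢ Icc (0:ℝ) T :=
    ⟨Metric.mem_closedBall_self hRpos.le, ht₁.1.le, ht₁.2.le⟩
  obtain ⟨⟨x₀, t₀⟩, hmem, hmin⟩ := hlsc2.exists_isMinOn ⟨_, hmem1⟩ hcomp
  have hneg : F (u (x₀, t₀)) - w (x₀, t₀) < 0 := by
    have h1 : F (u (x₀, t₀)) - w (x₀, t₀) ≤ F (u (z, t₁)) - w (z, t₁) := hmin hmem1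
    have h2 : w (z, t₁) = M - a * t₁ - M * (t₁ / T) ^ (N + 1) := by simp [hw, hτ]
    linarith
  obtain ⟨hx₀, ht₀⟩ := hmem
  simp only at hx₀ ht₀
  have hu0 : 0 < u (x₀, t₀) := hupos x₀ t₀ ht₀
  have hFu0 := hFnn _ hu0
  have hsq : 0 ≤ b * ‖x₀ - z‖ ^ 2 := by positivity
  have hpw : 0 ≤ M * (t₀ / T) ^ (N + 1) := by
    have := div_nonneg ht₀.1 hT.le
    positivity
  have hat0 : 0 ≤ a * t₀ := mul_nonneg hapos.le ht₀.1
  have hwv : w (x₀, t₀) = M - a * t₀ - M * (t₀ / T) ^ (N + 1) - b * ‖x₀ - z‖ ^ 2 := rfl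
  have hx₀' : ‖x₀ - z‖ < R := by
    by_contra! hge
    have : b * R ^ 2 ≤ b * ‖x₀ - z‖ ^ 2 := by gcongr
    linarith
  have ht0pos : 0 < t₀ := by
    rcases ht₀.1.eq_or_lt with h | h
    · exfalso
      subst h
      have h1 : M ≤ F (u (x₀, 0)) := hFm ((hmg x₀).trans (hinit x₀))
      linarith
    · exact h
  have ht0T : t₀ < T := by
    rcases ht₀.2.eq_or_lt with h | h
    · exfalso
      rw [h, div_self hT.ne', one_pow] at hwv
      have : 0 < a * T := by positivity
      rw [h] at hneg hFu0
      linarith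
    · exact h
  -- the test function
  set κ : ℝ := f (u (x₀, t₀)) ^ (1 / k₁) with hκ
  have hfu : 0 < f (u (x₀, t₀)) := hfpos _ hu0
  have hκpos : 0 < κ := Real.rpow_pos_of_pos hfu _
  have hκk : κ ^ k₁ = f (u (x₀, t₀)) := by
    rw [hκ, ← Real.rpow_mul hfu.le, one_div_mul_cancel hk₁.ne', Real.rpow_one]
  have key := hsuper (fun x t => κ * τ t + (-(κ * b)) * ‖x - z‖ ^ 2)
    (fun t => by
      have : ContDiff ℝ 2 fun x : EuclideanSpace ℝ (Fin n) => ‖x - z‖ ^ 2 :=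
        (contDiff_id.sub contDiff_const).norm_sq ℝ
      fun_prop)
    (fun x => by fun_prop) x₀ t₀ ⟨mem_univ _, ht0pos, ht0T⟩ (by
      have hU : Metric.ball z R ×ˢ (univ : Set ℝ) ∈ nhds (x₀, t₀) :=
        (Metric.isOpen_ball.prod isOpen_univ).mem_nhds
          ⟨by simpa [dist_eq_norm] using hx₀', mem_univ _⟩
      filter_upwards [mem_nhdsWithin_of_mem_nhds hU, self_mem_nhdsWithin] with p hp1 hp2
      have hpt : p.2 ∈ Icc (0:ℝ) T := ⟨hp2.2.1.le, hp2.2.2.le⟩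
      have hpm : p ∈ Metric.closedBall z R ×ˢ Icc (0:ℝ) T :=
        ⟨Metric.ball_subset_closedBall hp1.1, hpt⟩
      have h1 : F (u (x₀, t₀)) - w (x₀, t₀) ≤ F (u p) - w p := hmin hpm
      have hup : 0 < u p := hupos p.1 p.2 hpt
      have h2 := hFconc (u p) (u (x₀, t₀)) hup hu0
      rw [← hκ] at h2
      have h3 : w p - w (x₀, t₀) ≤ κ⁻¹ * (u p - u (x₀, t₀)) := by linarith
      have h4 : κ * (w p - w (x₀, t₀)) ≤ u p - u (x₀, t₀) := by
        calc κ * (w p - w (x₀, t₀)) ≤ κ * (κ⁻¹ * (u p - u (x₀, t₀))) := by gcongr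
          _ = _ := by field_simp
      simp only [hw] at h4
      linarith)
  rw [quad_grad, quad_hess] at key
  have hτd : HasDerivAt τ (-a - M * ((N + 1 : ℕ) * (t₀ / T) ^ N * (1 / T))) t₀ := by
    have h1 : HasDerivAt (fun t : ℝ => (t / T) ^ (N + 1))
        ((N + 1 : ℕ) * (t₀ / T) ^ N * (1 / T)) t₀ := by
      exact ((hasDerivAt_id t₀).div_const T).pow (N + 1)
    have h2 : HasDerivAt (fun t : ℝ => M - a * t) (-a) t₀ := by
      simpa using ((hasDerivAt_id t₀).const_mul a).const_sub M
    exact h2.sub (h1.const_mul M)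
  have hd := ((hτd.const_mul κ).add_const (-(κ * b) * ‖x₀ - z‖ ^ 2)).deriv
  rw [hd] at key
  set D : ℝ := -a - M * ((N + 1 : ℕ) * (t₀ / T) ^ N * (1 / T)) with hD
  have hDa : D ≤ -a := by
    have : 0 ≤ M * ((N + 1 : ℕ) * (t₀ / T) ^ N * (1 / T)) := by
      have := div_nonneg ht₀.1 hT.le
      positivity
    rw [hD]; linarith
  have hv : (2 * -(κ * b)) • (x₀ - z) = (-(κ * (2 * b * R))) • (R⁻¹ • (x₀ - z)) := by
    rw [smul_smul]; congr 1; field_simp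
  have hX : (2 * -(κ * b)) • (1 : Matrix (Fin n) (Fin n) ℝ) = (κ * (2 * b)) • (-1) := by
    rw [smul_neg, ← neg_smul]; congr 1; ring
  have hs : 0 < 2 * b * R := by positivity
  rw [hv, hX] at key
  beta_reduce at key
  rw [hH.hom_q, hH.hom_X _ (by positivity), abs_neg, abs_of_pos (by positivity),
    Real.mul_rpow hκpos.le hs.le, hκk] at key
  have hball : ‖R⁻¹ • (x₀ - z)‖ ≤ 1 := by
    rw [norm_smul, norm_inv, Real.norm_of_nonneg hRpos.le, inv_mul_le_iff₀ hRpos]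
    linarith
  have hCy := hC _ hball
  set P : ℝ := H (R⁻¹ • (x₀ - z)) (-1) with hP
  have hS1 : (2 * b * R) ^ k₁ ≤ 1 := by
    apply Real.rpow_le_one hs.le _ hk₁.le
    have : 2 * b * R * R = 2 * M := by rw [← hbR]; ring
    by_contra! hgt
    have : 1 * R < 2 * b * R * R := by gcongr
    linarith
  have hS0 : 0 ≤ (2 * b * R) ^ k₁ := Real.rpow_nonneg hs.le _
  set S : ℝ := (2 * b * R) ^ k₁ with hS
  have hkey2 : f (u (x₀, t₀)) * κ * (S * (2 * b) * P - D) ≤ 0 := by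
    calc _ = f (u (x₀, t₀)) * S * (κ * (2 * b) * P) - f (u (x₀, t₀)) * (κ * D) := by ring
      _ ≤ 0 := key
  have hfk : 0 < f (u (x₀, t₀)) * κ := by positivity
  have h5 : S * (2 * b) * P - D ≤ 0 := by
    by_contra! hgt
    exact absurd hkey2 (not_le.2 (mul_pos hfk hgt))
  have h6 : S * (2 * b) * (-C) ≤ S * (2 * b) * P := by gcongr
  have h7 : S * (2 * b * C) ≤ 1 * (2 * b * C) := by gcongr
  have h8 : 2 * b * C < a := by
    have e1 : 2 * b * C * R ^ 2 = 2 * M * C := by rw [← hbR]; ring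
    have e2 : a * R ≤ a * R ^ 2 := by
      have : R ≤ R ^ 2 := by nlinarith
      gcongr
    have e3 : 2 * b * C * R ^ 2 < a * R ^ 2 := by linarith
    exact lt_of_mul_lt_mul_right e3 (by positivity)
  linarith
end
end

section
/- Minimum principle for doubly nonlinear equations, divergent integral case (Theorem 2.8(b), case (2.71.0)(ii)): Suppose H satisfies Conditions A–C with k₁ > 0 (so k > 1, γ = k₁ + 2 > 2, γ* = γ/(γ−2)) and Λ^sup < ∞. Let f : [0,∞) → [0,∞) be a C¹ increasing function with f(s) > 0 for s > 0 and such that s ↦ f(s)^{1/(k−1)} is concave, and suppose that ∫₀¹ f(θ)^{−1/(k−1)} dθ = ∞. Let φ : ℝ → (0,∞) be a C² increasing function with φ′(τ) = f(φ(τ))^{1/(k−1)} for all τ ∈ ℝ. Let g : ℝⁿ → (0,∞) be continuous with 0 < inf_{ℝⁿ} g ≤ sup_{ℝⁿ} g < ∞. If u is lower semicontinuous on the closure of ℝⁿ_T with u > 0, a viscosity supersolution of H(Du, D²u) − f(u)u_t = 0 in ℝⁿ_T, u(x,0) ≥ g(x) for all x ∈ ℝⁿ, and there is a function ρ ≥ 0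 with ρ(R)/R^{γ*} → 0 as R → ∞ such that inf_{B^R_T} u ≥ φ(−ρ(R)) for all large R, then u(x,t) ≥ inf_{ℝⁿ} g for all (x,t) ∈ ℝⁿ_T. -/
open Set MeasureTheory

noncomputable section

open Filter

lemma grad_aux {n : ℕ} (Φ : ℝ → ℝ) (hΦ : ContDiff ℝ 2 Φ) (a c β : ℝ) (z x : EuclideanSpace ℝ (Fin n)) (j : Fin n) :
    fderiv ℝ (fun y => Φ (a - c * (1 + ‖y - z‖^2)^β)) x (EuclideanSpace.single j 1)
     = deriv Φ (a - c * (1 + ‖x - z‖^2)^β) * (-(c * (β * (1 + ‖x - z‖^2)^(β-1) * (2 * (x - z) j)))) := by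
  have h1 : HasFDerivAt (fun y : EuclideanSpace ℝ (Fin n) => y - z) (ContinuousLinearMap.id ℝ _) x :=
    (hasFDerivAt_id x).sub_const z
  have h2 := h1.norm_sq.const_add 1
  have hQ : (1 + ‖x - z‖^2) ≠ 0 := by positivity
  have h3 := ((((Real.hasDerivAt_rpow_const (p := β) (Or.inl hQ)).comp_hasFDerivAt x h2).const_mul c).const_sub a)
  have h4 := ((hΦ.differentiable (by norm_num)) (a - c * (1 + ‖x - z‖^2)^β)).hasDerivAt.comp_hasFDerivAt x h3
  have h5 := h4.fderiv
  simp only [Function.comp_def] at h5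
  rw [h5]
  simp [EuclideanSpace.inner_single_right]

lemma hess_aux {n : ℕ} (Φ : ℝ → ℝ) (hΦ : ContDiff ℝ 2 Φ) (a c β : ℝ) (z x : EuclideanSpace ℝ (Fin n)) (i j : Fin n) :
    fderiv ℝ (fun y => deriv Φ (a - c * (1 + ‖y - z‖^2)^β) * (-(c * (β * (1 + ‖y - z‖^2)^(β-1) * (2 * (y - z) j))))) x (EuclideanSpace.single i 1)
     = (deriv (deriv Φ) (a - c * (1 + ‖x - z‖^2)^β) * (2 * c * β * (1 + ‖x - z‖^2)^(β-1))^2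
        - deriv Φ (a - c * (1 + ‖x - z‖^2)^β) * (4 * c * β * (β-1) * (1 + ‖x - z‖^2)^(β-1-1))) * ((x-z) i * (x-z) j)
       + (-(deriv Φ (a - c * (1 + ‖x - z‖^2)^β) * (2 * c * β * (1 + ‖x - z‖^2)^(β-1)))) * (if i = j then 1 else 0) := by
  have h1 : HasFDerivAt (fun y : EuclideanSpace ℝ (Fin n) => y - z) (ContinuousLinearMap.id ℝ _) x :=
    (hasFDerivAt_id x).sub_const z
  have h2 := h1.norm_sq.const_add 1
  have hQ : (1 + ‖x - z‖^2) ≠ 0 := by positivity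
  have h3 := ((((Real.hasDerivAt_rpow_const (p := β) (Or.inl hQ)).comp_hasFDerivAt x h2).const_mul c).const_sub a)
  have hd : Differentiable ℝ (deriv Φ) := by
    have : ContDiff ℝ (1+1) Φ := by simpa [one_add_one_eq_two] using hΦ
    exact (contDiff_succ_iff_deriv.1 this).2.2.differentiable (by norm_num)
  have h4 := (hd (a - c * (1 + ‖x - z‖^2)^β)).hasDerivAt.comp_hasFDerivAt x h3
  have h6 := (Real.hasDerivAt_rpow_const (p := β-1) (Or.inl hQ)).comp_hasFDerivAt x h2
  have h7 := (EuclideanSpace.proj j : EuclideanSpace ℝ (Fin n) →L[ℝ] ℝ).hasFDerivAt.comp x h1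
  have h8 := h4.mul (((h6.const_mul β).mul (h7.const_mul 2)).const_mul c).neg
  have h5 := h8.fderiv
  have e : (fun y => deriv Φ (a - c * (1 + ‖y - z‖^2)^β) * (-(c * (β * (1 + ‖y - z‖^2)^(β-1) * (2 * (y - z) j))))) = (fun y => (deriv Φ ∘ fun y => a - c * (1 + ‖y - z‖^2)^β) y * (-(c * (β * ((fun y => y ^(β-1)) ∘ fun y => (1 + ‖y - z‖^2)) y * (2 * ((EuclideanSpace.proj j : EuclideanSpace ℝ (Fin n) →L[ℝ] ℝ) ∘ fun y => y - z) y))))) := by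
    funext y; simp
  rw [e]
  refine (congrArg (fun L => L (EuclideanSpace.single i 1)) h5).trans ?_
  by_cases h : i = j
  · subst h
    simp [EuclideanSpace.inner_single_right]
    ring
  · have h' : j ≠ i := fun e => h e.symm
    simp [EuclideanSpace.inner_single_right, h, h']
    ring

lemma H_lower {n : ℕ} {H : EuclideanSpace ℝ (Fin n) → Matrix (Fin n) (Fin n) ℝ → ℝ} {k₁ : ℝ}
    (hH : ConditionsABC n H k₁) (hk : 0 < k₁) :
    ∃ M > 0, ∀ q, -(M * ‖q‖ ^ k₁) ≤ H q (-1) := by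
  have hc : Continuous fun q => H q (-1) :=
    hH.continuous.comp (continuous_id.prodMk continuous_const)
  obtain ⟨m, hm⟩ := ((isCompact_closedBall (0 : EuclideanSpace ℝ (Fin n)) 1).image hc).bddBelow
  refine ⟨|m| + 1, by positivity, fun q => ?_⟩
  by_cases hq : q = 0
  · have := hH.hom_q 0 0 (-1)
    simp [Real.zero_rpow hk.ne'] at this
    simp [hq, this, Real.zero_rpow hk.ne']
  · have hq' : 0 < ‖q‖ := norm_pos_iff.2 hq
    have h1 := hH.hom_q ‖q‖ (‖q‖⁻¹ • q) (-1)
    rw [smul_smul, mul_inv_cancel₀ hq'.ne', one_smul, abs_of_pos hq'] at h1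
    have h2 : m ≤ H (‖q‖⁻¹ • q) (-1) := hm ⟨_, by simp [norm_smul, hq'.ne'], rfl⟩
    rw [h1]
    have h3 : 0 ≤ ‖q‖ ^ k₁ := by positivity
    have h4 : -(|m| + 1) ≤ H (‖q‖⁻¹ • q) (-1) := by linarith [neg_abs_le m]
    nlinarith

lemma outer_psd {n : ℕ} (p : EuclideanSpace ℝ (Fin n)) : (outerProd p).PosSemidef := by
  have := Matrix.posSemidef_vecMulVec_self_star (R := ℝ) p.ofLp
  convert this using 1
  ext i j
  simp [outerProd, Matrix.vecMulVec_apply]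

lemma outer_psd' {n : ℕ} (p : EuclideanSpace ℝ (Fin n)) (Q : ℝ) (hQ : ‖p‖ ^ 2 ≤ Q) :
    (Q • (1 : Matrix (Fin n) (Fin n) ℝ) - outerProd p).PosSemidef := by
  refine Matrix.PosSemidef.of_dotProduct_mulVec_nonneg ?_ ?_
  · ext i j
    simp [outerProd, mul_comm, Matrix.one_apply, eq_comm]
  · intro x
    have h := real_inner_mul_inner_self_le p (WithLp.toLp 2 x)
    rw [real_inner_self_eq_norm_sq] at h
    have h0 : (0:ℝ) ≤ inner ℝ (WithLp.toLp 2 x) (WithLp.toLp 2 x) := real_inner_self_nonneg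
    have e1 : inner ℝ p (WithLp.toLp 2 x) = x ⬝ᵥ p.ofLp := by
      simp [EuclideanSpace.inner_eq_star_dotProduct]
    have e2 : inner ℝ (WithLp.toLp 2 x) (WithLp.toLp 2 x) = x ⬝ᵥ x := by
      rw [EuclideanSpace.inner_eq_star_dotProduct]; simp
    have e3 : (outerProd p).mulVec x = (x ⬝ᵥ p.ofLp) • p.ofLp := by
      ext i
      simp only [Matrix.mulVec, outerProd, dotProduct, Matrix.of_apply, Pi.smul_apply, smul_eq_mul, Finset.sum_mul]
      exact Finset.sum_congr rfl fun j _ => by ring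
    rw [Matrix.sub_mulVec, e3, dotProduct_sub, Matrix.smul_mulVec, Matrix.one_mulVec]
    simp only [star_trivial, dotProduct_smul, smul_eq_mul]
    rw [e1, e2] at h
    rw [e2] at h0
    nlinarith

lemma key_ineq {n : ℕ} {H : EuclideanSpace ℝ (Fin n) → Matrix (Fin n) (Fin n) ℝ → ℝ} {k₁ : ℝ}
    (hH : ConditionsABC n H k₁) (hk : 0 < k₁) :
    ∃ C > 0, ∀ (Φ : ℝ → ℝ), ContDiff ℝ 2 Φ → (∀ τ, 0 < deriv Φ τ) → (∀ τ, 0 ≤ deriv (deriv Φ) τ) →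
      ∀ (a c : ℝ) (z x : EuclideanSpace ℝ (Fin n)), 0 < c →
      -(C * c ^ (k₁ + 1) * (deriv Φ (a - c * (1 + ‖x - z‖^2)^((k₁+2)/(2*k₁)))) ^ (k₁ + 1) *
          (1 + ‖x - z‖^2)^((k₁+2)/(2*k₁))) ≤
       H (spaceGrad (fun y => Φ (a - c * (1 + ‖y - z‖^2)^((k₁+2)/(2*k₁)))) x)
         (spaceHess (fun y => Φ (a - c * (1 + ‖y - z‖^2)^((k₁+2)/(2*k₁)))) x) := by
  obtain ⟨M, hM, hHM⟩ := H_lower hH hk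
  set β := (k₁+2)/(2*k₁) with hβ
  have hβ0 : 0 < β := by positivity
  refine ⟨M * (2 * β + 4 * β * |β - 1|) * (2 * β) ^ k₁, by positivity, ?_⟩
  intro Φ hΦ hΦ1 hΦ2 a c z x hc
  set Q := 1 + ‖x - z‖^2 with hQdef
  have hQ : 0 < Q := by positivity
  set B := deriv Φ (a - c * Q ^ β) with hB
  have hB0 : 0 < B := hΦ1 _
  set B2 := deriv (deriv Φ) (a - c * Q ^ β) with hB2
  have hB20 : 0 ≤ B2 := hΦ2 _
  set L := B * c * (4 * β * |β - 1|) * Q ^ (β-1-1) with hL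
  have hL0 : 0 ≤ L := by positivity
  set E := B * c * (2 * β + 4 * β * |β - 1|) * Q ^ (β-1) with hE
  have hE0 : 0 < E := by positivity
  set A := B2 * (2 * c * β * Q^(β-1))^2 - B * (4 * c * β * (β-1) * Q^(β-1-1)) with hA
  have hg : spaceGrad (fun y => Φ (a - c * (1 + ‖y - z‖^2)^β)) x =
      (-(B * (2 * c * β * Q^(β-1)))) • (x - z) := by
    ext i
    simp only [spaceGrad]
    simp only [grad_aux Φ hΦ]
    simp
    ring
  have hh : spaceHess (fun y => Φ (a - c * (1 + ‖y - z‖^2)^β)) x =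
      A • outerProd (x - z) + (-(B * (2 * c * β * Q^(β-1)))) • (1 : Matrix (Fin n) (Fin n) ℝ) := by
    ext i j
    simp only [spaceHess, Matrix.of_apply]
    simp only [grad_aux Φ hΦ, hess_aux Φ hΦ]
    simp [outerProd, Matrix.one_apply, hA, hB, hB2, hQdef]
    split_ifs <;> simp
  have hQQ : Q ^ (β - 1 - 1) * Q = Q ^ (β - 1) := by
    rw [← Real.rpow_add_one hQ.ne']; congr 1; ring
  have hpsd : LoewnerLE (E • (-1 : Matrix (Fin n) (Fin n) ℝ))
      (spaceHess (fun y => Φ (a - c * (1 + ‖y - z‖^2)^β)) x) := by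
    unfold LoewnerLE
    have hAL : 0 ≤ A + L := by
      have : A + L = B2 * (2 * c * β * Q^(β-1))^2 + B * c * (4 * β) * Q ^ (β-1-1) * (|β - 1| - (β - 1)) := by
        rw [hA, hL]; ring
      rw [this]
      have := sub_nonneg.2 (le_abs_self (β - 1))
      positivity
    have h1 := ((outer_psd (x - z)).smul hAL).add ((outer_psd' (x - z) Q (by linarith)).smul hL0)
    convert h1 using 1
    rw [hh]
    have : E = B * (2 * c * β * Q^(β-1)) + L * Q := by
      rw [hE, hL, mul_assoc _ _ Q, hQQ]; ring
    rw [this]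
    simp only [add_smul, smul_sub, smul_smul, smul_neg, neg_smul]
    abel
  have hsym : (spaceHess (fun y => Φ (a - c * (1 + ‖y - z‖^2)^β)) x).IsSymm := by
    rw [hh]
    ext i j
    simp [outerProd, Matrix.one_apply, mul_comm, eq_comm]
  have hmono := hH.monotone (spaceGrad (fun y => Φ (a - c * (1 + ‖y - z‖^2)^β)) x) _ _ (by
    ext i j; simp [Matrix.one_apply, eq_comm]) hsym hpsd
  refine le_trans ?_ hmono
  rw [hH.hom_X E hE0, hg, hH.hom_q, abs_neg,
    abs_of_pos (show 0 < B * (2 * c * β * Q ^ (β - 1)) by positivity)]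
  have h5 := hHM (x - z)
  have h6 : ‖x - z‖ ^ k₁ ≤ Q ^ (k₁ / 2) := by
    have : ‖x - z‖ ≤ Q ^ (1/2 : ℝ) := by
      rw [← Real.sqrt_eq_rpow]
      exact Real.le_sqrt_of_sq_le (by linarith)
    calc ‖x - z‖ ^ k₁ ≤ (Q ^ (1/2 : ℝ)) ^ k₁ := by gcongr
      _ = _ := by rw [← Real.rpow_mul hQ.le]; congr 1; ring
  have h7 : -(M * Q ^ (k₁ / 2)) ≤ H (x - z) (-1) := by
    refine le_trans ?_ h5
    gcongr
  have h8 : E * ((B * (2 * c * β * Q ^ (β - 1))) ^ k₁ * (-(M * Q ^ (k₁ / 2)))) ≤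
      E * ((B * (2 * c * β * Q ^ (β - 1))) ^ k₁ * H (x - z) (-1)) := by gcongr
  refine le_trans (le_of_eq ?_) h8
  have e1 : (B * (2 * c * β * Q ^ (β - 1))) ^ k₁ = B ^ k₁ * c ^ k₁ * (2 * β) ^ k₁ * Q ^ ((β - 1) * k₁) := by
    rw [Real.rpow_mul hQ.le, ← Real.mul_rpow, ← Real.mul_rpow, ← Real.mul_rpow] <;> first | positivity | skip
    congr 1; ring
  have e2 : Q ^ (β - 1) * (Q ^ ((β - 1) * k₁) * Q ^ (k₁ / 2)) = Q ^ β := by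
    rw [← Real.rpow_add hQ, ← Real.rpow_add hQ]
    congr 1
    rw [hβ]; field_simp; ring
  rw [e1, ← e2, hE, Real.rpow_add_one hB0.ne', Real.rpow_add_one hc.ne']
  ring

lemma phi_surj {f φ : ℝ → ℝ} {k₁ : ℝ} (hk₁ : 0 < k₁) (hfmono : StrictMonoOn f (Ici 0))
    (hfpos : ∀ s : ℝ, 0 < s → 0 < f s) (hφpos : ∀ τ, 0 < φ τ) (hφsmooth : ContDiff ℝ 2 φ)
    (hφmono : StrictMono φ) (hφode : ∀ τ : ℝ, deriv φ τ = f (φ τ) ^ (1 / k₁)) :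
    ∀ s > 0, ∃ τ, φ τ = s := by
  intro s hs
  have hd := hφsmooth.differentiable (by norm_num)
  apply mem_range_of_exists_le_of_exists_ge hφsmooth.continuous
  · by_contra! hcon
    set d := f s ^ (1 / k₁)
    have hd0 : 0 < d := Real.rpow_pos_of_pos (hfpos s hs) _
    have hle : ∀ τ, d ≤ deriv φ τ := fun τ => by
      rw [hφode]
      exact Real.rpow_le_rpow (hfpos s hs).le (hfmono.monotoneOn hs.le (hφpos τ).le (hcon τ).le) (by positivity)
    have h1 := mul_sub_le_image_sub_of_le_deriv hd hle (x := -(φ 0 / d)) (y := 0) (by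
      have := hφpos 0
      have : 0 ≤ φ 0 / d := by positivity
      linarith)
    have h2 := hφpos (-(φ 0 / d))
    have h3 : d * (0 - -(φ 0 / d)) = φ 0 := by field_simp; ring
    linarith
  · set d := deriv φ 0 with hd'
    have hd0 : 0 < d := by rw [hd', hφode]; exact Real.rpow_pos_of_pos (hfpos _ (hφpos 0)) _
    have h1 := (convex_Ici (0:ℝ)).mul_sub_le_image_sub_of_le_deriv hd.continuous.continuousOn hd.differentiableOn
      (C := d) (by
        intro x hx
        rw [interior_Ici] at hx
        rw [hd', hφode, hφode]
        exact Real.rpow_le_rpow (hfpos _ (hφpos 0)).le (hfmono.monotoneOn (hφpos 0).le (hφpos x).le (hφmono.monotone (le_of_lt hx))) (by positivity))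
      0 self_mem_Ici (s / d) (by simp; positivity) (by positivity)
    refine ⟨s / d, ?_⟩
    have := hφpos 0
    have h3 : d * (s / d - 0) = s := by field_simp; ring
    linarith

set_option maxHeartbeats 2000000 in
/-- **Theorem 2.8(b), divergent-integral case** (minimum principle for the doubly nonlinear
equation `H(Du,D²u) - f(u)u_t = 0`, `k = k₁ + 1 > 1`, when `∫₀¹ f(θ)^{-1/(k-1)} dθ = ∞`).
Here `γ* = (k₁+2)/k₁` and `φ : ℝ → (0,∞)` is a C² increasing solution of
`φ' = f(φ)^{1/(k-1)}`; the growth condition is `inf_{B^R_T} u ≥ φ(-o(R^{γ*}))`. -/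
theorem minimum_principle_doubly_nonlinear_divergent
    (n : ℕ) (hn : 2 ≤ n)
    (H : EuclideanSpace ℝ (Fin n) → Matrix (Fin n) (Fin n) ℝ → ℝ) (k₁ : ℝ)
    (hH : ConditionsABC n H k₁) (hk₁ : 0 < k₁)
    (hΛ : LambdaSupFinite n H)
    (T : ℝ) (hT : 0 < T)
    (f : ℝ → ℝ) (hf1 : ContDiffOn ℝ 1 f (Ici 0)) (hfmono : StrictMonoOn f (Ici 0))
    (hfnonneg : ∀ s ∈ Ici (0:ℝ), 0 ≤ f s) (hfpos : ∀ s : ℝ, 0 < s → 0 < f s)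
    (hfconc : ConcaveOn ℝ (Ici 0) fun s => f s ^ (1 / k₁))
    (hfint : ¬ IntegrableOn (fun θ : ℝ => f θ ^ (-(1 / k₁))) (Ioo (0:ℝ) 1))
    (φ : ℝ → ℝ) (hφpos : ∀ τ, 0 < φ τ) (hφsmooth : ContDiff ℝ 2 φ)
    (hφmono : StrictMono φ)
    (hφode : ∀ τ : ℝ, deriv φ τ = f (φ τ) ^ (1 / k₁))
    (g : EuclideanSpace ℝ (Fin n) → ℝ) (hgcont : Continuous g)
    (hgpos : ∃ c > (0:ℝ), ∀ x, c ≤ g x) (hgbdd : BddAbove (Set.range g))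
    (u : EuclideanSpace ℝ (Fin n) × ℝ → ℝ)
    (hlsc : LowerSemicontinuousOn u (univ ×ˢ Icc 0 T))
    (hupos : ∀ (x : EuclideanSpace ℝ (Fin n)), ∀ t ∈ Icc 0 T, 0 < u (x, t))
    (hsuper : ParabolicSupersolution
      (fun _ r q X pt => H q X - f r * pt) (univ ×ˢ Ioo 0 T) u)
    (hinit : ∀ x, g x ≤ u (x, 0))
    (z : EuclideanSpace ℝ (Fin n))
    (hgrow : ∃ ρ : ℝ → ℝ, (∀ R, 0 ≤ ρ R) ∧
      Tendsto (fun R => ρ R / R ^ ((k₁ + 2) / k₁)) atTop (nhds 0) ∧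
      ∀ᶠ R in atTop, ∀ (x : EuclideanSpace ℝ (Fin n)) (t : ℝ),
        ‖x - z‖ ≤ R → t ∈ Ioo 0 T → φ (-ρ R) ≤ u (x, t)) :
    ∀ (x : EuclideanSpace ℝ (Fin n)), ∀ t ∈ Ioo 0 T, (⨅ y, g y) ≤ u (x, t) := by
  classical
  obtain ⟨ρ, hρ0, hρ, hgr⟩ := hgrow
  obtain ⟨C, hC, hkey⟩ := key_ineq hH hk₁
  have hsurj := phi_surj hk₁ hfmono hfpos hφpos hφsmooth hφmono hφode
  choose! inv hinv using hsurj
  have hd := hφsmooth.differentiable (by norm_num)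
  have hφ1 : ∀ τ, 0 < deriv φ τ := fun τ => by
    rw [hφode]; exact Real.rpow_pos_of_pos (hfpos _ (hφpos τ)) _
  have hφ2 : ∀ τ, 0 ≤ deriv (deriv φ) τ := fun τ => by
    apply Monotone.deriv_nonneg
    intro a b hab
    rw [hφode, hφode]
    exact Real.rpow_le_rpow (hfpos _ (hφpos a)).le
      (hfmono.monotoneOn (hφpos a).le (hφpos b).le (hφmono.monotone hab)) (by positivity)
  have hφk : ∀ τ, f (φ τ) = deriv φ τ ^ k₁ := fun τ => by
    rw [hφode, ← Real.rpow_mul (hfpos _ (hφpos τ)).le, one_div, inv_mul_cancel₀ hk₁.ne', Real.rpow_one]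
  obtain ⟨cg, hcg, hcg'⟩ := hgpos
  have hbdd : BddBelow (range g) := ⟨cg, by rintro _ ⟨x, rfl⟩; exact hcg' x⟩
  have hinf : 0 < ⨅ y, g y := lt_of_lt_of_le hcg (le_ciInf hcg')
  set μ := inv (⨅ y, g y) with hμ
  have hφμ : φ μ = ⨅ y, g y := hinv _ hinf
  intro x₁ t₁ ht₁
  by_contra! hlt
  set v : EuclideanSpace ℝ (Fin n) × ℝ → ℝ := fun p => inv (u p) with hv
  have hφv : ∀ x, ∀ t ∈ Icc 0 T, φ (v (x, t)) = u (x, t) := fun x t ht => hinv _ (hupos x t ht)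
  have hv1 : v (x₁, t₁) < μ := by
    rw [← hφmono.lt_iff_lt, hφμ, hφv _ _ (Ioo_subset_Icc_self ht₁)]; exact hlt
  set β := (k₁+2)/(2*k₁) with hβ
  have hβ0 : 0 < β := by positivity
  -- choice of c₀
  obtain ⟨c₀, hc₀, hc1, hc2⟩ : ∃ c₀ > 0, c₀ * ((1 + t₁) * (1 + ‖x₁ - z‖^2)^β + 1) < μ - v (x₁, t₁) ∧
      C * c₀ ^ k₁ * (1 + T) ^ (k₁ + 1) < 1 := by
    have l1 : Tendsto (fun c : ℝ => c * ((1 + t₁) * (1 + ‖x₁ - z‖^2)^β + 1)) (nhdsWithin 0 (Ioi 0)) (nhds (0 * _)) :=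
      (tendsto_id.mul_const _).mono_left nhdsWithin_le_nhds
    have l2 : Tendsto (fun c : ℝ => C * c ^ k₁ * (1 + T) ^ (k₁ + 1)) (nhdsWithin 0 (Ioi 0)) (nhds (C * 0 ^ k₁ * (1 + T) ^ (k₁ + 1))) :=
      ((((Real.continuousAt_rpow_const 0 k₁ (Or.inr hk₁.le)).tendsto.const_mul C).mul_const _)).mono_left nhdsWithin_le_nhds
    rw [zero_mul] at l1
    rw [Real.zero_rpow hk₁.ne', mul_zero, zero_mul] at l2
    have := ((l1.eventually_lt_const (sub_pos.2 hv1)).and (l2.eventually_lt_const one_pos)).and self_mem_nhdsWithin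
    obtain ⟨c, ⟨h1, h2⟩, h3⟩ := this.exists
    exact ⟨c, h3, h1, h2⟩
  -- choice of R₀
  have hγ : 0 < (k₁ + 2) / k₁ := by positivity
  have hE1 : ∀ᶠ R : ℝ in atTop, ρ R / R ^ ((k₁ + 2) / k₁) < c₀ / 2 :=
    hρ.eventually_lt_const (by positivity)
  have hE2 : ∀ᶠ R : ℝ in atTop, 2 * μ / c₀ ≤ R ^ ((k₁ + 2) / k₁) :=
    (tendsto_rpow_atTop hγ).eventually_ge_atTop _
  obtain ⟨R₀, hR₀⟩ := eventually_atTop.1 (((hE1.and hE2).and hgr).and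
    ((eventually_gt_atTop (0:ℝ)).and (eventually_ge_atTop ‖x₁ - z‖)))
  have hR₀pos : 0 < R₀ := (hR₀ R₀ le_rfl).2.1
  have hvR : ∀ R ≥ R₀, ∀ x, ∀ t ∈ Ioo 0 T, ‖x - z‖ ≤ R → -ρ R ≤ v (x, t) := fun R hR x t ht hx => by
    rw [← hφmono.le_iff_le, hφv _ _ (Ioo_subset_Icc_self ht)]
    exact (hR₀ R hR).1.2 x t hx ht
  have hQR : ∀ x : EuclideanSpace ℝ (Fin n), ‖x - z‖ ^ ((k₁ + 2) / k₁) ≤ (1 + ‖x - z‖^2)^β := fun x => by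
    calc ‖x - z‖ ^ ((k₁ + 2) / k₁) = (‖x - z‖^2)^β := by
          rw [← Real.rpow_natCast, ← Real.rpow_mul (norm_nonneg _)]
          congr 1; rw [hβ]; push_cast; field_simp
      _ ≤ _ := by gcongr; linarith
  -- choice of S, K
  obtain ⟨S, hS1, hS2⟩ := exists_between ht₁.2
  obtain ⟨K, hK0, hK⟩ : ∃ K > 0, ρ R₀ + μ ≤ c₀ * Real.exp (K * (S - t₁)) := by
    have hst : 0 < S - t₁ := sub_pos.2 hS1
    have : Tendsto (fun K : ℝ => c₀ * Real.exp (K * (S - t₁))) atTop atTop :=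
      (Real.tendsto_exp_atTop.comp (tendsto_id.atTop_mul_const hst)).const_mul_atTop hc₀
    obtain ⟨K, h1, h2⟩ := ((this.eventually_ge_atTop (ρ R₀ + μ)).and (eventually_gt_atTop 0)).exists
    exact ⟨K, h2, h1⟩
  set w : EuclideanSpace ℝ (Fin n) × ℝ → ℝ := fun p =>
    (μ - c₀ * Real.exp (K * (p.2 - t₁))) - c₀ * (1 + p.2) * (1 + ‖p.1 - z‖^2)^β with hw
  have hwcont : Continuous w := by
    have : Continuous fun p : EuclideanSpace ℝ (Fin n) × ℝ => (1 + ‖p.1 - z‖^2)^β :=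
      Continuous.rpow_const (by fun_prop) (fun p => Or.inl (by positivity))
    fun_prop
  have hlscv : LowerSemicontinuousOn v (Metric.closedBall z R₀ ×ˢ Icc 0 S) := by
    rintro ⟨x, t⟩ ⟨_, ht⟩ a ha
    have htT : t ∈ Icc 0 T := ⟨ht.1, ht.2.trans hS2.le⟩
    have hua : φ a < u (x, t) := by rw [← hφv _ _ htT]; exact hφmono ha
    have h1 := hlsc (x, t) ⟨mem_univ _, htT⟩ _ hua
    have hsub : Metric.closedBall z R₀ ×ˢ Icc 0 S ⊆ (univ ×ˢ Icc 0 T : Set (EuclideanSpace ℝ (Fin n) × ℝ)) :=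
      prod_mono (subset_univ _) (Icc_subset_Icc_right hS2.le)
    filter_upwards [h1.filter_mono (nhdsWithin_mono _ hsub), self_mem_nhdsWithin] with p hp hp'
    show a < v p
    rw [← hφmono.lt_iff_lt, ← Prod.mk.eta (p := p), hφv _ _ (hsub hp').2]
    exact hp
  have hlscd : LowerSemicontinuousOn (fun p => v p + -w p) (Metric.closedBall z R₀ ×ˢ Icc 0 S) :=
    hlscv.add (hwcont.neg.lowerSemicontinuous.lowerSemicontinuousOn _)
  have hmem1 : (x₁, t₁) ∈ Metric.closedBall z R₀ ×ˢ Icc 0 S :=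
    ⟨by rw [Metric.mem_closedBall, dist_eq_norm]; exact (hR₀ R₀ le_rfl).2.2, ht₁.1.le, hS1.le⟩
  obtain ⟨⟨x₀, t₀⟩, hmem0, hmin⟩ := LowerSemicontinuousOn.exists_isMinOn ⟨_, hmem1⟩
    ((isCompact_closedBall z R₀).prod isCompact_Icc) hlscd
  set m := v (x₀, t₀) + -w (x₀, t₀) with hm
  have hmneg : m < 0 := by
    have h1 : m ≤ v (x₁, t₁) + -w (x₁, t₁) := hmin hmem1
    have h2 : w (x₁, t₁) = μ - c₀ * ((1 + t₁) * (1 + ‖x₁ - z‖^2)^β + 1) := by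
      simp [hw]; ring
    linarith
  have hx₀ : ‖x₀ - z‖ ≤ R₀ := by rw [← dist_eq_norm]; exact hmem0.1
  have ht0S : t₀ ∈ Icc 0 S := hmem0.2
  have hQ1 : ∀ x : EuclideanSpace ℝ (Fin n), 0 < (1 + ‖x - z‖^2)^β := fun x => by positivity
  have ht0pos : 0 < t₀ := by
    rcases ht0S.1.eq_or_lt with h | h
    · exfalso
      have h1 : μ ≤ v (x₀, t₀) := by
        rw [← hφmono.le_iff_le, hφμ, hφv _ _ ⟨ht0S.1, ht0S.2.trans hS2.le⟩, ← h]
        exact (ciInf_le hbdd x₀).trans (hinit x₀)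
      have h2 : w (x₀, t₀) ≤ μ := by
        simp only [hw]
        have := hQ1 x₀
        have := ht0S.1
        have a1 : 0 ≤ c₀ * Real.exp (K * (t₀ - t₁)) := by positivity
        have a2 : 0 ≤ c₀ * (1 + t₀) * (1 + ‖x₀ - z‖^2)^β := by positivity
        linarith
      linarith
    · exact h
  have ht0T : t₀ ∈ Ioo 0 T := ⟨ht0pos, ht0S.2.trans_lt hS2⟩
  have ht0lt : t₀ < S := by
    rcases ht0S.2.eq_or_lt with h | h
    · exfalso
      have h1 := hvR R₀ le_rfl x₀ t₀ ht0T hx₀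
      have h2 : w (x₀, t₀) ≤ μ - c₀ * Real.exp (K * (S - t₁)) := by
        simp only [hw, h]
        have := hQ1 x₀
        have : 0 < S := h ▸ ht0pos
        have a2 : 0 ≤ c₀ * (1 + S) * (1 + ‖x₀ - z‖^2)^β := by positivity
        linarith
      linarith
    · exact h
  have hx₀lt : ‖x₀ - z‖ < R₀ := by
    rcases hx₀.eq_or_lt with h | h
    · exfalso
      have h1 := hvR R₀ le_rfl x₀ t₀ ht0T hx₀
      obtain ⟨⟨⟨h3, h4⟩, -⟩, -⟩ := hR₀ R₀ le_rfl
      have hRp : 0 < R₀ ^ ((k₁ + 2) / k₁) := by positivity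
      rw [div_lt_iff₀ hRp] at h3
      rw [div_le_iff₀ hc₀] at h4
      have h5 := hQR x₀
      rw [h] at h5
      have h2 : w (x₀, t₀) ≤ μ - c₀ * R₀ ^ ((k₁ + 2) / k₁) := by
        simp only [hw, h]
        have a1 : 0 ≤ c₀ * Real.exp (K * (t₀ - t₁)) := by positivity
        have a2 : c₀ * 1 * R₀ ^ ((k₁ + 2) / k₁) ≤ c₀ * (1 + t₀) * (1 + R₀^2)^β := by
          gcongr; linarith
        linarith
      linarith
    · exact h
  -- the test function
  have hloc : IsLocalMinOn (fun p => u p - (fun x t => φ (w (x, t) + m)) p.1 p.2) (univ ×ˢ Ioo 0 T) (x₀, t₀) := by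
    have hnb : (Metric.ball z R₀ ×ˢ Ioo 0 S) ∈ nhds (x₀, t₀) :=
      (Metric.isOpen_ball.prod isOpen_Ioo).mem_nhds
        ⟨by rw [Metric.mem_ball, dist_eq_norm]; exact hx₀lt, ht0pos, ht0lt⟩
    filter_upwards [mem_nhdsWithin_of_mem_nhds hnb] with p hp
    obtain ⟨x, t⟩ := p
    have hp2 : t ∈ Ioo 0 S := hp.2
    have htT : t ∈ Icc 0 T := ⟨hp2.1.le, hp2.2.le.trans hS2.le⟩
    have h1 : m ≤ v (x, t) + -w (x, t) :=
      hmin (show (x, t) ∈ _ from ⟨Metric.ball_subset_closedBall hp.1, hp2.1.le, hp2.2.le⟩)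
    have h2 : φ (w (x, t) + m) ≤ u (x, t) := by
      rw [← hφv _ _ htT]; exact hφmono.monotone (by linarith)
    have h3 : φ (w (x₀, t₀) + m) = u (x₀, t₀) := by
      rw [← hφv _ _ (Ioo_subset_Icc_self ht0T)]; congr 1; rw [hm]; ring
    simp only
    rw [h3]; linarith
  have hQsm : ContDiff ℝ 2 fun x : EuclideanSpace ℝ (Fin n) => (1 + ‖x - z‖^2)^β := by
    refine ContDiff.rpow_const_of_ne ?_ (fun x => by positivity)
    exact contDiff_const.add ((contDiff_id.sub contDiff_const).norm_sq ℝ)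
  have htest := hsuper (fun x t => φ (w (x, t) + m))
    (fun t => hφsmooth.comp (by simp only [hw]; fun_prop))
    (fun x => (hφsmooth.of_le (by norm_num)).comp (by simp only [hw]; fun_prop))
    x₀ t₀ ⟨mem_univ _, ht0T⟩ hloc
  set c := c₀ * (1 + t₀) with hc
  have hcpos : 0 < c := by positivity
  set Q := (1 + ‖x₀ - z‖^2)^β with hQ
  have hQpos : 0 < Q := hQ1 x₀
  have hk := hkey φ hφsmooth hφ1 hφ2 (μ - c₀ * Real.exp (K * (t₀ - t₁)) + m) c z x₀ hcpos
  have hfun : (fun x => φ (w (x, t₀) + m)) =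
      fun y => φ ((μ - c₀ * Real.exp (K * (t₀ - t₁)) + m) - c * (1 + ‖y - z‖^2)^β) := by
    funext y; congr 1; simp only [hw]; ring
  have hval : (μ - c₀ * Real.exp (K * (t₀ - t₁)) + m) - c * Q = v (x₀, t₀) := by
    rw [hm]; simp only [hw]; ring
  have hwv : w (x₀, t₀) + m = v (x₀, t₀) := by rw [hm]; ring
  set B := deriv φ (v (x₀, t₀)) with hB
  have hBpos : 0 < B := hφ1 _
  have hderiv : deriv (fun t => φ (w (x₀, t) + m)) t₀ =
      B * (-(c₀ * (Real.exp (K * (t₀ - t₁)) * K)) - c₀ * Q) := by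
    have h1 : HasDerivAt (fun t => w (x₀, t) + m) (-(c₀ * (Real.exp (K * (t₀ - t₁)) * (K * 1))) - c₀ * 1 * Q) t₀ := by
      simp only [hw]
      exact ((((((hasDerivAt_id t₀).sub_const t₁).const_mul K).exp.const_mul c₀).const_sub μ).sub
        ((((hasDerivAt_id t₀).const_add 1).const_mul c₀).mul_const Q)).add_const m
    have h2 := (hd (w (x₀, t₀) + m)).hasDerivAt.comp t₀ h1
    have h3 := h2.deriv
    rw [hwv] at h3
    simpa [Function.comp_def] using h3
  have hfu : f (u (x₀, t₀)) = B ^ k₁ := by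
    rw [← hφv _ _ (Ioo_subset_Icc_self ht0T), hφk]
  simp only at htest
  rw [hderiv, hfu, hfun] at htest
  rw [hval] at hk
  have hfin := hk.trans (sub_nonpos.1 htest)
  have hBk : 0 < B ^ k₁ := by positivity
  rw [Real.rpow_add_one hBpos.ne'] at hfin
  have hexp : 0 ≤ B ^ k₁ * B * (c₀ * (Real.exp (K * (t₀ - t₁)) * K)) := by positivity
  have hfin2 : (B ^ k₁ * B * Q) * c₀ ≤ (B ^ k₁ * B * Q) * (C * c ^ (k₁ + 1)) := by
    nlinarith
  have hfin3 : c₀ ≤ C * c ^ (k₁ + 1) := le_of_mul_le_mul_left hfin2 (by positivity)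
  have hcle : c ^ (k₁ + 1) ≤ (c₀ * (1 + T)) ^ (k₁ + 1) := by
    have := ht0T.2
    refine Real.rpow_le_rpow hcpos.le ?_ (by positivity)
    rw [hc]
    gcongr
  rw [Real.mul_rpow (x := c₀) (y := 1 + T) hc₀.le (by positivity), Real.rpow_add_one hc₀.ne'] at hcle
  have hfin4 : C * c ^ (k₁ + 1) ≤ C * (c₀ ^ k₁ * c₀ * (1 + T) ^ (k₁ + 1)) := mul_le_mul_of_nonneg_left hcle hC.le
  have : C * (c₀ ^ k₁ * c₀ * (1 + T) ^ (k₁ + 1)) = c₀ * (C * c₀ ^ k₁ * (1 + T) ^ (k₁ + 1)) := by ring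
  nlinarith
end
end
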